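/- arXiv:0904.1641 — 2 statements merged into one kernel-verified Lean document; each statement's English description precedes it below -/
import Mathlib

section
/- For all real a, b with 0 < a ≤ b < 1, ∫_a^b f(-q)^5 / (f(-q^5) · q) dq = arcsinh((11 + u(a))/2) − arcsinh((11 + u(b))/2). -/
open MeasureTheory Real

/-- Euler's product `f(-q) = ∏_{n=1}^∞ (1 - qⁿ)`. -/
noncomputable def eulerF (q : ℝ) : ℝ := ∏' n : ℕ, (1 - q ^ (n + 1))

/-- `u(q) = f(-q)⁶ / (q · f(-q⁵)⁶)`. -/
noncomputable def uF (q : ℝ) : ℝ := eulerF q ^ 6 / (q * eulerF (q ^ 5) ^ 6)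

namespace LevelFive

open Complex hiding eta
open ModularForm Filter Topology

local notation "𝕢" => Function.Periodic.qParam

lemma qParam_one_periodic : Function.Periodic (𝕢 1) 1 := fun z ↦ by
  simp only [Function.Periodic.qParam]
  rw [show 2 * π * I * (z + 1) / ((1 : ℝ) : ℂ) = 2 * π * I * z / ((1 : ℝ) : ℂ) + 2 * π * I by
    push_cast; ring, Complex.exp_periodic]

lemma sq_eta_add_one (z : ℂ) : eta (z + 1) ^ 2 = cexp (π * I / 6) * eta z ^ 2 := by
  have h24 : 𝕢 24 (z + 1) ^ 2 = cexp (π * I / 6) * 𝕢 24 z ^ 2 := by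
    simp only [Function.Periodic.qParam, ← Complex.exp_nat_mul, ← Complex.exp_add]
    congr 1
    push_cast
    ring
  simp only [eta, eta_q, qParam_one_periodic z, mul_pow, h24, mul_assoc]

lemma sq_eta_sub_two (z : ℂ) : cexp (π * I / 6) ^ 2 * eta (z - 2) ^ 2 = eta z ^ 2 := by
  have h1 := sq_eta_add_one (z - 2)
  have h2 := sq_eta_add_one (z - 2 + 1)
  rw [show z - 2 + 1 + 1 = z by ring] at h2
  rw [h2, h1]
  ring

lemma neg_one_div_im_pos {z : ℂ} (hz : 0 < z.im) : 0 < (-1 / z).im := by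
  simpa [neg_div] using UpperHalfPlane.im_inv_neg_coe_pos ⟨z, hz⟩

lemma sq_eta_neg_one_div {z : ℂ} (hz : 0 < z.im) : eta (-1 / z) ^ 2 = -I * z * eta z ^ 2 := by
  have h := eta_comp_eq_csqrt_I_inv (show z ∈ UpperHalfPlane.upperHalfPlaneSet from hz)
  have hs (w : ℂ) : Complex.sqrt w ^ 2 = w := by simp [Complex.sqrt]
  simp only [Function.comp_apply, Pi.smul_apply, Pi.mul_apply, smul_eq_mul] at h
  rw [h, mul_pow, mul_pow, inv_pow, hs, hs, Complex.inv_I]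
  ring

lemma ne_zero_of_im_pos {z : ℂ} (hz : 0 < z.im) : z ≠ 0 := by
  rintro rfl
  simp at hz

lemma five_mul_im_pos {z : ℂ} (hz : 0 < z.im) : 0 < (5 * z).im := by
  simpa using hz

lemma sq_eta_elliptic {z : ℂ} (hz : 0 < z.im) :
    eta ((2 * z - 1) / (5 * z - 2)) ^ 2 = -I * (5 * z - 2) * eta z ^ 2 := by
  have hz0 := ne_zero_of_im_pos hz
  have him1 := neg_one_div_im_pos hz
  have him2 : 0 < (-1 / z + 2).im := by simpa using him1
  have hw0 := ne_zero_of_im_pos him2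
  have him3 := neg_one_div_im_pos him2
  have him4 : 0 < (-1 / (-1 / z + 2) - 2).im := by simpa using him3
  have h1 := sq_eta_sub_two (-1 / z + 2)
  have h2 := sq_eta_sub_two (-1 / (-1 / z + 2))
  have h0 : 2 * z - 1 ≠ 0 := ne_zero_of_im_pos (by simpa using hz)
  have h5 : 5 * z - 2 ≠ 0 := ne_zero_of_im_pos (by simpa using hz)
  have hw : -1 / z + 2 = (2 * z - 1) / z := by field_simp; ring
  have hv : -1 / (-1 / z + 2) - 2 = -(5 * z - 2) / (2 * z - 1) := by
    rw [hw]; field_simp; ring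
  have he : (2 * z - 1) / (5 * z - 2) = -1 / (-1 / (-1 / z + 2) - 2) := by
    rw [hv]; field_simp
  rw [he, sq_eta_neg_one_div him4]
  rw [sq_eta_neg_one_div him2, ← h1, show -1 / z + 2 - 2 = -1 / z by ring,
    sq_eta_neg_one_div hz] at h2
  have hζ : cexp (π * I / 6) ^ 2 ≠ 0 := pow_ne_zero _ (Complex.exp_ne_zero _)
  have h3 : eta (-1 / (-1 / z + 2) - 2) ^ 2 =
      -I * (-1 / z + 2) * (-I * z * eta z ^ 2) := by
    apply mul_left_cancel₀ hζ
    rw [h2]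
    ring
  rw [h3, hv, hw]
  have hc : -(5 * z - 2) / (2 * z - 1) * ((2 * z - 1) / z) * z = -(5 * z - 2) := by
    rw [div_mul_div_cancel₀ h0, div_mul_cancel₀ _ hz0]
  linear_combination -I ^ 3 * eta z ^ 2 * hc + (5 * z - 2) * eta z ^ 2 * Complex.I_pow_three

lemma sq_eta_five_mul_elliptic {z : ℂ} (hz : 0 < z.im) :
    eta (5 * ((2 * z - 1) / (5 * z - 2))) ^ 2 = -I * (5 * z - 2) * eta (5 * z) ^ 2 := by
  have him : 0 < (5 * z - 2).im := by simpa using hz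
  have h5 := ne_zero_of_im_pos him
  have he : 5 * ((2 * z - 1) / (5 * z - 2)) - 2 = -1 / (5 * z - 2) := by field_simp; ring
  have h1 := sq_eta_sub_two (5 * ((2 * z - 1) / (5 * z - 2)))
  rw [← h1, he, sq_eta_neg_one_div him, ← sq_eta_sub_two (5 * z)]
  ring

/-- The Hauptmodul `(η(z) / η(5 * z))⁶` of `Γ₀(5)`. -/
noncomputable def hauptmodul (z : ℂ) : ℂ := eta z ^ 6 / eta (5 * z) ^ 6

/-- The cusp form `η(z)⁴ η(5 * z)⁴` of weight four and level five. -/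
noncomputable def etaForm (z : ℂ) : ℂ := eta z ^ 4 * eta (5 * z) ^ 4

/-- The defect of the differential equation satisfied by the Hauptmodul of `Γ₀(5)`,
normalised to weight zero. -/
noncomputable def defect (z : ℂ) : ℂ :=
  (logDeriv hauptmodul z / (2 * π * I)) ^ 2 / etaForm z - hauptmodul z - 22 - 125 / hauptmodul z

lemma hauptmodul_ne_zero {z : ℂ} (hz : 0 < z.im) : hauptmodul z ≠ 0 :=
  div_ne_zero (pow_ne_zero _ (eta_ne_zero hz)) (pow_ne_zero _ (eta_ne_zero (five_mul_im_pos hz)))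

lemma differentiableAt_hauptmodul {z : ℂ} (hz : 0 < z.im) :
    DifferentiableAt ℂ hauptmodul z := by
  have h1 := differentiableAt_eta_of_mem_upperHalfPlaneSet hz
  have h5 : DifferentiableAt ℂ (fun w ↦ eta (5 * w)) z :=
    (differentiableAt_eta_of_mem_upperHalfPlaneSet (five_mul_im_pos hz)).comp z
      (f := fun w ↦ 5 * w) (by fun_prop)
  exact (h1.fun_pow 6).fun_div (h5.fun_pow 6) (pow_ne_zero _ (eta_ne_zero (five_mul_im_pos hz)))

lemma eventually_im_pos {z : ℂ} (hz : 0 < z.im) : ∀ᶠ w in 𝓝 z, 0 < w.im :=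
  Complex.continuous_im.continuousAt.eventually (lt_mem_nhds hz)

lemma etaForm_ne_zero {z : ℂ} (hz : 0 < z.im) : etaForm z ≠ 0 :=
  mul_ne_zero (pow_ne_zero _ (eta_ne_zero hz)) (pow_ne_zero _ (eta_ne_zero (five_mul_im_pos hz)))

lemma sq_logDeriv_div_etaForm {m : ℂ → ℂ} {m' z : ℂ} (hz : 0 < z.im) (hmz : 0 < (m z).im)
    (hm : HasDerivAt m m' z) (hA : etaForm (m z) * m' ^ 2 = etaForm z)
    (hU : logDeriv (hauptmodul ∘ m) z ^ 2 = logDeriv hauptmodul z ^ 2) :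
    (logDeriv hauptmodul (m z) / (2 * π * I)) ^ 2 / etaForm (m z) =
      (logDeriv hauptmodul z / (2 * π * I)) ^ 2 / etaForm z := by
  rw [logDeriv_comp (differentiableAt_hauptmodul hmz) hm.differentiableAt, hm.deriv, mul_pow] at hU
  have hAz := etaForm_ne_zero hz
  have hAm := etaForm_ne_zero hmz
  rw [div_pow, div_pow, div_right_comm, div_right_comm (logDeriv hauptmodul z ^ 2)]
  congr 1
  rw [div_eq_div_iff hAm hAz, ← hU, ← hA]
  ring

lemma hauptmodul_elliptic {z : ℂ} (hz : 0 < z.im) :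
    hauptmodul ((2 * z - 1) / (5 * z - 2)) = hauptmodul z := by
  have h5 : 5 * z - 2 ≠ 0 := ne_zero_of_im_pos (by simpa using hz)
  have h (a : ℂ) : a ^ 6 = (a ^ 2) ^ 3 := by ring
  simp only [hauptmodul]
  rw [h, h (eta (5 * _)), sq_eta_elliptic hz, sq_eta_five_mul_elliptic hz, mul_pow _ (_ ^ 2),
    mul_pow _ (eta (5 * z) ^ 2),
    mul_div_mul_left _ _ (pow_ne_zero _ (mul_ne_zero (neg_ne_zero.2 Complex.I_ne_zero) h5)),
    ← h, ← h]

lemma etaForm_elliptic {z : ℂ} (hz : 0 < z.im) :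
    etaForm ((2 * z - 1) / (5 * z - 2)) = (5 * z - 2) ^ 4 * etaForm z := by
  have h (a : ℂ) : a ^ 4 = (a ^ 2) ^ 2 := by ring
  simp only [etaForm]
  rw [h (eta _), h (eta (5 * _)), sq_eta_elliptic hz, sq_eta_five_mul_elliptic hz]
  have hI : I ^ 4 = 1 := Complex.I_pow_four
  linear_combination ((5 * z - 2) ^ 4 * eta z ^ 4 * eta (5 * z) ^ 4) * hI

lemma elliptic_im_pos {z : ℂ} (hz : 0 < z.im) : 0 < ((2 * z - 1) / (5 * z - 2)).im := by
  have him : 0 < (5 * z - 2).im := by simpa using hz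
  have h5 := ne_zero_of_im_pos him
  have he : (2 * z - 1) / (5 * z - 2) = ((1 / 5 : ℝ) : ℂ) * (2 + -1 / (5 * z - 2)) := by
    rw [eq_comm]; push_cast; field_simp; ring
  rw [he, Complex.im_ofReal_mul]
  have := neg_one_div_im_pos him
  simpa using this

lemma defect_elliptic {z : ℂ} (hz : 0 < z.im) :
    defect ((2 * z - 1) / (5 * z - 2)) = defect z := by
  have h5 : 5 * z - 2 ≠ 0 := ne_zero_of_im_pos (by simpa using hz)
  have hm : HasDerivAt (fun w : ℂ ↦ (2 * w - 1) / (5 * w - 2)) (1 / (5 * z - 2) ^ 2) z := by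
    convert! (((hasDerivAt_id z).const_mul 2).sub_const 1).div
      (((hasDerivAt_id z).const_mul 5).sub_const 2) h5 using 1
    simp only [id]
    field_simp
    ring_nf
  have hU : logDeriv (hauptmodul ∘ fun w : ℂ ↦ (2 * w - 1) / (5 * w - 2)) z =
      logDeriv hauptmodul z := by
    have he : hauptmodul ∘ (fun w : ℂ ↦ (2 * w - 1) / (5 * w - 2)) =ᶠ[𝓝 z] hauptmodul := by
      filter_upwards [eventually_im_pos hz] with w hw using hauptmodul_elliptic hw
    rw [logDeriv_apply, logDeriv_apply, he.deriv_eq, he.eq_of_nhds]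
  simp only [defect]
  rw [sq_logDeriv_div_etaForm (m := fun w ↦ (2 * w - 1) / (5 * w - 2)) hz (elliptic_im_pos hz) hm
    (by rw [etaForm_elliptic hz]; field_simp) (by rw [hU]), hauptmodul_elliptic hz]

lemma five_mul_fricke {z : ℂ} : 5 * (-1 / (5 * z)) = -1 / z := by
  field_simp

lemma fricke_im_pos {z : ℂ} (hz : 0 < z.im) : 0 < (-1 / (5 * z)).im :=
  neg_one_div_im_pos (five_mul_im_pos hz)

lemma hauptmodul_fricke {z : ℂ} (hz : 0 < z.im) :
    hauptmodul (-1 / (5 * z)) = 125 / hauptmodul z := by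
  have hz0 := ne_zero_of_im_pos hz
  have h (a : ℂ) : a ^ 6 = (a ^ 2) ^ 3 := by ring
  have e1 := eta_ne_zero hz
  have e5 := eta_ne_zero (five_mul_im_pos hz)
  have hI : I ≠ 0 := Complex.I_ne_zero
  simp only [hauptmodul]
  rw [five_mul_fricke, h, h (eta (-1 / z)), sq_eta_neg_one_div hz,
    sq_eta_neg_one_div (five_mul_im_pos hz)]
  field_simp
  ring

lemma etaForm_fricke {z : ℂ} (hz : 0 < z.im) :
    etaForm (-1 / (5 * z)) = 25 * z ^ 4 * etaForm z := by
  have h (a : ℂ) : a ^ 4 = (a ^ 2) ^ 2 := by ring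
  simp only [etaForm]
  rw [five_mul_fricke, h (eta _), h (eta (-1 / z)), sq_eta_neg_one_div hz,
    sq_eta_neg_one_div (five_mul_im_pos hz)]
  have hI : I ^ 4 = 1 := Complex.I_pow_four
  linear_combination (25 * z ^ 4 * eta z ^ 4 * eta (5 * z) ^ 4) * hI

lemma defect_fricke {z : ℂ} (hz : 0 < z.im) : defect (-1 / (5 * z)) = defect z := by
  have hz0 := ne_zero_of_im_pos hz
  have hm : HasDerivAt (fun w : ℂ ↦ -1 / (5 * w)) (1 / (5 * z ^ 2)) z := by
    convert! (hasDerivAt_const z (-1 : ℂ)).div ((hasDerivAt_id z).const_mul 5) (by simpa) using 1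
    simp only [id]
    field_simp
    ring_nf
  have hU : logDeriv (hauptmodul ∘ fun w : ℂ ↦ -1 / (5 * w)) z = -logDeriv hauptmodul z := by
    have he : hauptmodul ∘ (fun w : ℂ ↦ -1 / (5 * w)) =ᶠ[𝓝 z] fun w ↦ 125 * (hauptmodul w)⁻¹ := by
      filter_upwards [eventually_im_pos hz] with w hw
      rw [Function.comp_apply, hauptmodul_fricke hw, div_eq_mul_inv]
    have hinv := logDeriv_fun_zpow (differentiableAt_hauptmodul hz) (-1)
    simp only [zpow_neg_one, Int.cast_neg, Int.cast_one, neg_one_mul] at hinv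
    rw [logDeriv_apply, he.deriv_eq, he.eq_of_nhds, ← logDeriv_apply,
      logDeriv_const_mul _ _ (by norm_num), hinv]
  simp only [defect]
  have hn := hauptmodul_ne_zero hz
  rw [sq_logDeriv_div_etaForm (m := fun w ↦ -1 / (5 * w)) hz (fricke_im_pos hz) hm
    (by rw [etaForm_fricke hz]; field_simp; norm_num [mul_comm]) (by rw [hU]; ring),
    hauptmodul_fricke hz]
  field_simp
  ring

/-- Euler's product `∏ (1 - qⁿ)` as a function of a complex variable. -/
noncomputable def eulerC (q : ℂ) : ℂ := ∏' n : ℕ, (1 - q ^ (n + 1))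

lemma eulerC_ne_zero {q : ℂ} (hq : ‖q‖ < 1) : eulerC q ≠ 0 := by
  simp only [eulerC, sub_eq_add_neg]
  refine tprod_one_add_ne_zero_of_summable (f := fun n ↦ -q ^ (n + 1)) (fun i h ↦ ?_) ?_
  · have h1 : q ^ (i + 1) = 1 := by linear_combination -h
    have h2 := congrArg norm h1
    rw [norm_pow, norm_one] at h2
    exact (pow_lt_one₀ (norm_nonneg q) hq (Nat.succ_ne_zero i)).ne h2
  · simpa using (summable_nat_add_iff 1).mpr (summable_geometric_of_lt_one (norm_nonneg _) hq)

lemma differentiableOn_eulerC : DifferentiableOn ℂ eulerC (Metric.ball 0 1) :=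
  differentiableOn_tprod_one_sub_pow

lemma differentiableAt_eulerC {q : ℂ} (hq : ‖q‖ < 1) : DifferentiableAt ℂ eulerC q :=
  differentiableOn_eulerC.differentiableAt (Metric.isOpen_ball.mem_nhds (by simpa using hq))

lemma eulerC_zero : eulerC 0 = 1 := by
  simp [eulerC]

lemma deriv_eulerC_zero : deriv eulerC 0 = -1 := by
  have hl (n : ℕ) : logDeriv (fun q : ℂ ↦ 1 - q ^ (n + 1)) 0 = if n = 0 then -1 else 0 := by
    rw [logDeriv_apply, deriv_const_sub, deriv_pow_field]
    rcases n with - | n <;> simp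
  have h := logDeriv_tprod_eq_tsum (Metric.isOpen_ball (x := (0 : ℂ)) (ε := 1)) (x := 0)
    (by simp) (f := fun n q ↦ 1 - q ^ (n + 1)) (by simp) (fun i ↦ by fun_prop)
    (by simp only [hl]; exact (hasSum_ite_eq 0 _).summable)
    multipliableLocallyUniformlyOn_one_sub_pow (by simp)
  simp only [hl, tsum_ite_eq] at h
  change logDeriv eulerC 0 = -1 at h
  rwa [logDeriv_apply, eulerC_zero, div_one] at h

lemma norm_pow_five_lt_one {q : ℂ} (hq : ‖q‖ < 1) : ‖q ^ 5‖ < 1 := by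
  rw [norm_pow]
  exact pow_lt_one₀ (norm_nonneg q) hq (by norm_num)

lemma differentiableAt_deriv_eulerC {q : ℂ} (hq : ‖q‖ < 1) :
    DifferentiableAt ℂ (deriv eulerC) q :=
  (differentiableOn_eulerC.deriv Metric.isOpen_ball).differentiableAt
    (Metric.isOpen_ball.mem_nhds (by simpa using hq))

lemma differentiableAt_eulerC_pow_five {q : ℂ} (hq : ‖q‖ < 1) :
    DifferentiableAt ℂ (fun q ↦ eulerC (q ^ 5)) q :=
  (differentiableAt_eulerC (norm_pow_five_lt_one hq)).comp q (f := fun q ↦ q ^ 5) (by fun_prop)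

lemma differentiableAt_deriv_eulerC_pow_five {q : ℂ} (hq : ‖q‖ < 1) :
    DifferentiableAt ℂ (fun q ↦ deriv eulerC (q ^ 5)) q :=
  (differentiableAt_deriv_eulerC (norm_pow_five_lt_one hq)).comp q (f := fun q ↦ q ^ 5)
    (by fun_prop)

/-- The weight two Eisenstein series of level five, `1 + 6 ∑ n qⁿ / (1 - qⁿ) -
30 ∑ n q⁵ⁿ / (1 - q⁵ⁿ)`, written through logarithmic derivatives of Euler's product. -/
noncomputable def eisen (q : ℂ) : ℂ :=
  1 - 6 * (q * (deriv eulerC q / eulerC q)) +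
    30 * (q ^ 5 * (deriv eulerC (q ^ 5) / eulerC (q ^ 5)))

lemma differentiableAt_eisen {q : ℂ} (hq : ‖q‖ < 1) : DifferentiableAt ℂ eisen q := by
  have h1 := (differentiableAt_deriv_eulerC hq).fun_div (differentiableAt_eulerC hq)
    (eulerC_ne_zero hq)
  have h5 := (differentiableAt_deriv_eulerC_pow_five hq).fun_div
    (differentiableAt_eulerC_pow_five hq) (eulerC_ne_zero (norm_pow_five_lt_one hq))
  exact (((differentiableAt_id.fun_mul h1).const_mul 6).const_sub 1).fun_add
    (((differentiableAt_id.fun_pow 5).fun_mul h5).const_mul 30)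

lemma eisen_zero : eisen 0 = 1 := by
  simp [eisen]

lemma hasDerivAt_eisen_zero : HasDerivAt eisen 6 0 := by
  have h0 : ‖(0 : ℂ)‖ < 1 := by simp
  have h1 := ((differentiableAt_deriv_eulerC h0).fun_div (differentiableAt_eulerC h0)
    (eulerC_ne_zero h0)).hasDerivAt
  have h5 := ((differentiableAt_deriv_eulerC_pow_five h0).fun_div
    (differentiableAt_eulerC_pow_five h0) (eulerC_ne_zero (norm_pow_five_lt_one h0))).hasDerivAt
  refine (((((hasDerivAt_id (0 : ℂ)).fun_mul h1).const_mul 6).const_sub 1).fun_add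
    ((((hasDerivAt_id (0 : ℂ)).fun_pow 5).fun_mul h5).const_mul 30)).congr_deriv ?_
  simp [eulerC_zero, deriv_eulerC_zero]

/-- The numerator of the defect, as a function of the nome. -/
noncomputable def numer (q : ℂ) : ℂ :=
  eisen q ^ 2 * eulerC q ^ 2 * eulerC (q ^ 5) ^ 2 - eulerC q ^ 12 -
    22 * (q * (eulerC q ^ 6 * eulerC (q ^ 5) ^ 6)) - 125 * (q ^ 2 * eulerC (q ^ 5) ^ 12)

lemma differentiableAt_numer {q : ℂ} (hq : ‖q‖ < 1) : DifferentiableAt ℂ numer q := by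
  have h1 := differentiableAt_eulerC hq
  have h5 := differentiableAt_eulerC_pow_five hq
  have he := differentiableAt_eisen hq
  unfold numer
  fun_prop

lemma numer_zero : numer 0 = 0 := by
  simp [numer, eisen_zero, eulerC_zero]

lemma deriv_numer_zero : deriv numer 0 = 0 := by
  have h0 : ‖(0 : ℂ)‖ < 1 := by simp
  have h1 := deriv_eulerC_zero ▸ (differentiableAt_eulerC h0).hasDerivAt
  have h5 : HasDerivAt (fun q ↦ eulerC (q ^ 5)) 0 0 := by
    have := (differentiableAt_eulerC (norm_pow_five_lt_one h0)).hasDerivAt.comp (0 : ℂ)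
      (h := fun q ↦ q ^ 5) (hasDerivAt_pow 5 0)
    exact this.congr_deriv (by simp)
  have he := hasDerivAt_eisen_zero
  have hid := hasDerivAt_id (0 : ℂ)
  have h := (((((he.fun_pow 2).fun_mul (h1.fun_pow 2)).fun_mul (h5.fun_pow 2)).fun_sub
    (h1.fun_pow 12)).fun_sub
    ((hid.fun_mul ((h1.fun_pow 6).fun_mul (h5.fun_pow 6))).const_mul 22)).fun_sub
    (((hid.fun_pow 2).fun_mul (h5.fun_pow 12)).const_mul 125)
  refine (h.congr_deriv ?_).deriv
  simp [eisen_zero, eulerC_zero]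
  norm_num

/-- The defect as a function of the nome, extended holomorphically to the cusp. -/
noncomputable def defectNome (q : ℂ) : ℂ :=
  q * dslope (dslope numer 0) 0 q / (eulerC q ^ 6 * eulerC (q ^ 5) ^ 6)

lemma defectNome_zero : defectNome 0 = 0 := by
  simp [defectNome]

lemma defectNome_eq {q : ℂ} (hq : q ≠ 0) :
    defectNome q = numer q / (q * (eulerC q ^ 6 * eulerC (q ^ 5) ^ 6)) := by
  have h : q * dslope (dslope numer 0) 0 q = numer q / q := by
    rw [dslope_of_ne _ hq, slope_def_field, dslope_of_ne _ hq, slope_def_field, dslope_same,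
      deriv_numer_zero, numer_zero]
    field_simp
    ring
  rw [defectNome, h, div_div]

lemma differentiableOn_defectNome : DifferentiableOn ℂ defectNome (Metric.ball 0 1) := by
  have hn : DifferentiableOn ℂ numer (Metric.ball 0 1) := fun q hq ↦
    (differentiableAt_numer (by simpa using hq)).differentiableWithinAt
  have hb : Metric.ball (0 : ℂ) 1 ∈ 𝓝 0 := Metric.ball_mem_nhds _ one_pos
  have hd := (Complex.differentiableOn_dslope hb).2 ((Complex.differentiableOn_dslope hb).2 hn)
  refine (differentiableOn_id.fun_mul hd).fun_div (fun q hq ↦ ?_) fun q hq ↦ ?_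
  · have hq : ‖q‖ < 1 := by simpa using hq
    exact (((differentiableAt_eulerC hq).fun_pow 6).fun_mul
      ((differentiableAt_eulerC_pow_five hq).fun_pow 6)).differentiableWithinAt
  · have hq : ‖q‖ < 1 := by simpa using hq
    exact mul_ne_zero (pow_ne_zero _ (eulerC_ne_zero hq))
      (pow_ne_zero _ (eulerC_ne_zero (norm_pow_five_lt_one hq)))

lemma qParam_five_mul (z : ℂ) : 𝕢 1 (5 * z) = 𝕢 1 z ^ 5 := by
  simp only [Function.Periodic.qParam, ← Complex.exp_nat_mul]
  congr 1
  push_cast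
  ring

lemma eta_eq (z : ℂ) : eta z = 𝕢 24 z * eulerC (𝕢 1 z) := rfl

lemma eta_five_mul_eq (z : ℂ) : eta (5 * z) = 𝕢 24 z ^ 5 * eulerC (𝕢 1 z ^ 5) := by
  rw [eta_eq, qParam_five_mul]
  congr 1
  simp only [Function.Periodic.qParam, ← Complex.exp_nat_mul]
  congr 1
  push_cast
  ring

lemma qParam_pow_twentyfour (z : ℂ) : 𝕢 24 z ^ 24 = 𝕢 1 z := by
  simp only [Function.Periodic.qParam, ← Complex.exp_nat_mul]
  congr 1
  push_cast
  ring

lemma hauptmodul_eq (z : ℂ) :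
    hauptmodul z = eulerC (𝕢 1 z) ^ 6 / (𝕢 1 z * eulerC (𝕢 1 z ^ 5) ^ 6) := by
  have h0 := Function.Periodic.qParam_ne_zero (h := 24) z
  rw [hauptmodul, eta_five_mul_eq, eta_eq, ← qParam_pow_twentyfour, mul_pow, mul_pow,
    show (𝕢 24 z ^ 5) ^ 6 = 𝕢 24 z ^ 6 * 𝕢 24 z ^ 24 by ring, mul_assoc,
    mul_div_mul_left _ _ (pow_ne_zero _ h0)]

lemma etaForm_eq (z : ℂ) :
    etaForm z = 𝕢 1 z * (eulerC (𝕢 1 z) ^ 4 * eulerC (𝕢 1 z ^ 5) ^ 4) := by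
  rw [etaForm, eta_five_mul_eq, eta_eq, ← qParam_pow_twentyfour]
  ring

lemma hasDerivAt_eulerC_pow_five {q : ℂ} (hq : ‖q‖ < 1) :
    HasDerivAt (fun q ↦ eulerC (q ^ 5)) (deriv eulerC (q ^ 5) * (5 * q ^ 4)) q := by
  have := (differentiableAt_eulerC (norm_pow_five_lt_one hq)).hasDerivAt.comp q
    (h := fun q ↦ q ^ 5) (hasDerivAt_pow 5 q)
  exact this.congr_deriv (by norm_num)

lemma hasDerivAt_hauptmodul_nome {q : ℂ} (hq : ‖q‖ < 1) (hq0 : q ≠ 0) :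
    HasDerivAt (fun q ↦ eulerC q ^ 6 / (q * eulerC (q ^ 5) ^ 6))
      (-(eisen q * (eulerC q ^ 6 / (q * eulerC (q ^ 5) ^ 6)) / q)) q := by
  have n1 := eulerC_ne_zero hq
  have n5 := eulerC_ne_zero (norm_pow_five_lt_one hq)
  have h1 := (differentiableAt_eulerC hq).hasDerivAt
  have h5 := hasDerivAt_eulerC_pow_five hq
  refine ((h1.fun_pow 6).fun_div ((hasDerivAt_id q).fun_mul (h5.fun_pow 6))
    (mul_ne_zero hq0 (pow_ne_zero _ n5))).congr_deriv ?_
  simp only [id, eisen]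
  push_cast
  field_simp
  ring

lemma qParam_norm_lt_one {z : ℂ} (hz : 0 < z.im) : ‖𝕢 1 z‖ < 1 :=
  Function.Periodic.norm_qParam_lt_one one_pos hz

lemma logDeriv_hauptmodul {z : ℂ} (hz : 0 < z.im) :
    logDeriv hauptmodul z = -(2 * π * I) * eisen (𝕢 1 z) := by
  have hq := qParam_norm_lt_one hz
  have hq0 := Function.Periodic.qParam_ne_zero (h := 1) z
  have he : hauptmodul = (fun q ↦ eulerC q ^ 6 / (q * eulerC (q ^ 5) ^ 6)) ∘ 𝕢 1 :=
    funext hauptmodul_eq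
  have hd := hasDerivAt_hauptmodul_nome hq hq0
  have n1 := eulerC_ne_zero hq
  have n5 := eulerC_ne_zero (norm_pow_five_lt_one hq)
  have hqd := logDeriv_qParam 1 z
  rw [logDeriv_apply, div_eq_iff hq0] at hqd
  rw [he, logDeriv_comp hd.differentiableAt
    (Function.Periodic.differentiable_qParam.differentiableAt), logDeriv_apply, hd.deriv, hqd]
  push_cast
  field_simp

lemma defect_eq {z : ℂ} (hz : 0 < z.im) : defect z = defectNome (𝕢 1 z) := by
  have hq := qParam_norm_lt_one hz
  have hq0 := Function.Periodic.qParam_ne_zero (h := 1) z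
  have n1 := eulerC_ne_zero hq
  have n5 := eulerC_ne_zero (norm_pow_five_lt_one hq)
  rw [defectNome_eq hq0, defect, logDeriv_hauptmodul hz, neg_mul, neg_div,
    mul_div_cancel_left₀ _ Complex.two_pi_I_ne_zero, hauptmodul_eq, etaForm_eq, numer]
  field_simp

lemma defect_add_int {z : ℂ} (hz : 0 < z.im) (k : ℤ) : defect (z + k) = defect z := by
  have h := qParam_one_periodic.int_mul k z
  rw [mul_one] at h
  rw [defect_eq (by simpa using hz), h, defect_eq hz]

lemma defect_add_one_fricke {w : ℂ} (hw : 0 < w.im) :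
    defect (w / (5 * w + 1)) = defect w := by
  have h0 := ne_zero_of_im_pos hw
  have h1 : 5 * w + 1 ≠ 0 := ne_zero_of_im_pos (by simpa using hw)
  have h := fricke_im_pos hw
  have h' := defect_add_int h (-1)
  rw [defect_fricke hw, ← defect_fricke (by simpa using h)] at h'
  rw [← h']
  congr 1
  have : -1 / (5 * w) + ((-1 : ℤ) : ℂ) = -(5 * w + 1) / (5 * w) := by push_cast; field_simp; ring
  rw [this]
  field_simp

lemma defect_sub_one_fricke {w : ℂ} (hw : 0 < w.im) :
    defect (w / (1 - 5 * w)) = defect w := by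
  have h0 := ne_zero_of_im_pos hw
  have h1 : 5 * w - 1 ≠ 0 := ne_zero_of_im_pos (by simpa using hw)
  have h1' : 1 - 5 * w ≠ 0 := by rwa [← neg_sub, neg_ne_zero]
  have h := fricke_im_pos hw
  have h' := defect_add_int h 1
  rw [defect_fricke hw, ← defect_fricke (by simpa using h)] at h'
  rw [← h']
  congr 1
  have : -1 / (5 * w) + ((1 : ℤ) : ℂ) = -(1 - 5 * w) / (5 * w) := by push_cast; field_simp; ring
  rw [this]
  field_simp

lemma defect_fricke_elliptic {w : ℂ} (hw : 0 < w.im) :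
    defect ((-2 * w - 1) / (5 * w + 2)) = defect w := by
  have h0 := ne_zero_of_im_pos hw
  have h1 : 5 * w + 2 ≠ 0 := ne_zero_of_im_pos (by simpa using hw)
  have h2 : 2 * w + 1 ≠ 0 := ne_zero_of_im_pos (by simpa using hw)
  have h := fricke_im_pos hw
  rw [← defect_fricke hw, ← defect_elliptic h, ← defect_fricke (elliptic_im_pos h)]
  congr 1
  have : (2 * (-1 / (5 * w)) - 1) / (5 * (-1 / (5 * w)) - 2) =
      (5 * w + 2) / (5 * (2 * w + 1)) := by
    have e1 : 2 * (-1 / (5 * w)) - 1 = -(5 * w + 2) / (5 * w) := by field_simp; ring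
    have e2 : 5 * (-1 / (5 * w)) - 2 = -(2 * w + 1) / w := by field_simp; ring
    rw [e1, e2]
    field_simp
  rw [this]
  field_simp
  ring

/-- The values of the defect at the images of `z` under representatives of the cosets of
`Γ₀(5)` in the modular group, up to a Fricke involution. -/
def values (z : ℂ) : Set ℂ := insert (defect z) (Set.range fun j : ℤ ↦ defect ((z + j) / 5))

lemma add_int_div_five_im_pos {z : ℂ} (hz : 0 < z.im) (j : ℤ) : 0 < ((z + j) / 5).im := by
  have : ((z + j) / 5).im = z.im / 5 := by
    rw [show (5 : ℂ) = ((5 : ℝ) : ℂ) by norm_num, Complex.div_ofReal_im]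
    simp
  rw [this]
  positivity

lemma values_one_add {z : ℂ} (hz : 0 < z.im) : values (1 + z) = values z := by
  have h := defect_add_int hz 1
  rw [Int.cast_one, add_comm] at h
  rw [values, values, h, ← (Equiv.addLeft (1 : ℤ)).surjective.range_comp
    fun j : ℤ ↦ defect ((z + j) / 5)]
  simp only [Function.comp_def, Equiv.coe_addLeft]
  push_cast
  simp only [← add_assoc, add_comm]

lemma defect_neg_one_div_add_int_mem {z : ℂ} (hz : 0 < z.im) (j : ℤ) :
    defect ((-1 / z + j) / 5) ∈ values z := by
  have hz0 := ne_zero_of_im_pos hz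
  have hS := neg_one_div_im_pos hz
  obtain ⟨k, r, hr, rfl⟩ : ∃ k r : ℤ, (r = 0 ∨ r = 1 ∨ r = -1 ∨ r = 2 ∨ r = -2) ∧
      j = r + 5 * k := ⟨(j + 2) / 5, (j + 2) % 5 - 2, by omega, by omega⟩
  have hk := defect_add_int (add_int_div_five_im_pos hS r) k
  rw [show (-1 / z + (r + 5 * k : ℤ)) / 5 = (-1 / z + r) / 5 + k by push_cast; ring, hk]
  have hw (j : ℤ) := add_int_div_five_im_pos hz j
  rcases hr with rfl | rfl | rfl | rfl | rfl
  · left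
    rw [← defect_fricke hz]
    congr 1
    push_cast
    field_simp
    ring
  · refine .inr ⟨-1, ?_⟩
    simp only
    rw [← defect_add_one_fricke (hw _)]
    congr 1
    push_cast
    rw [show 5 * ((z + -1) / 5) + 1 = z by ring]
    field_simp
    ring
  · refine .inr ⟨1, ?_⟩
    simp only
    rw [← defect_sub_one_fricke (hw _)]
    congr 1
    push_cast
    rw [show 1 - 5 * ((z + 1) / 5) = -z by ring]
    field_simp
    ring
  · refine .inr ⟨2, ?_⟩
    simp only
    rw [← defect_elliptic (hw _)]
    congr 1
    push_cast
    rw [show 5 * ((z + 2) / 5) - 2 = z by ring]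
    field_simp
    ring
  · refine .inr ⟨-2, ?_⟩
    simp only
    rw [← defect_fricke_elliptic (hw _)]
    congr 1
    push_cast
    rw [show 5 * ((z + -2) / 5) + 2 = z by ring]
    field_simp
    ring

lemma values_neg_one_div_subset {z : ℂ} (hz : 0 < z.im) : values (-1 / z) ⊆ values z := by
  rintro _ (rfl | ⟨j, rfl⟩)
  · refine .inr ⟨0, ?_⟩
    have h := add_int_div_five_im_pos hz 0
    simp only
    rw [← defect_fricke h]
    congr 1
    push_cast
    field_simp
    ring
  · exact defect_neg_one_div_add_int_mem hz j

lemma values_neg_one_div {z : ℂ} (hz : 0 < z.im) : values (-1 / z) = values z := by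
  refine (values_neg_one_div_subset hz).antisymm ?_
  have h := values_neg_one_div_subset (neg_one_div_im_pos hz)
  have hz0 := ne_zero_of_im_pos hz
  rwa [show -1 / (-1 / z) = z by field_simp] at h

open UpperHalfPlane MatrixGroups in
lemma values_smul (γ : SL(2, ℤ)) (τ : ℍ) : values ↑(γ • τ) = values τ := by
  have hγ : γ ∈ Subgroup.closure {ModularGroup.S, ModularGroup.T} := by
    simp [SpecialLinearGroup.SL2Z_generators]
  induction hγ using Subgroup.closure_induction generalizing τ with
  | mem x hx =>
    rcases hx with rfl | rfl
    · rw [UpperHalfPlane.modular_S_smul, ← values_neg_one_div τ.im_pos]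
      congr 1
      rw [UpperHalfPlane.coe_mk, inv_neg, neg_div, one_div]
    · rw [UpperHalfPlane.modular_T_smul, ← values_one_add τ.im_pos]
      simp
  | one => simp
  | mul x y _ _ hx hy => rw [mul_smul, hx, hy]
  | inv x _ hx => rw [← hx, smul_inv_smul]

lemma exists_defect_eq {z : ℂ} (hz : 0 < z.im) :
    ∃ w : ℂ, 1 / 10 ≤ w.im ∧ defect z = defect w := by
  obtain ⟨γ, hγ⟩ := ModularGroup.exists_one_half_le_im_smul ⟨z, hz⟩
  have hv : defect z ∈ values ↑(γ • (⟨z, hz⟩ : UpperHalfPlane)) := by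
    rw [values_smul]
    exact .inl rfl
  rcases hv with h | ⟨j, h⟩
  · exact ⟨_, le_trans (by norm_num) hγ, h⟩
  · refine ⟨_, ?_, h.symm⟩
    rw [show (5 : ℂ) = ((5 : ℝ) : ℂ) by norm_num, Complex.div_ofReal_im]
    have := hγ
    rw [← UpperHalfPlane.coe_im] at this
    simp only [Complex.add_im, Complex.intCast_im]
    linarith

lemma defectNome_eq_zero {q : ℂ} (hq : ‖q‖ < 1) : defectNome q = 0 := by
  have hb : rexp (-2 * π * (1 / 10)) < 1 := by
    rw [Real.exp_lt_one_iff]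
    nlinarith [Real.pi_pos]
  have h := Complex.eq_const_of_exists_le differentiableOn_defectNome (Real.exp_pos _).le hb ?_
  · simpa [defectNome_zero] using h (show q ∈ Metric.ball 0 1 by simpa using hq)
  intro z hz
  rw [mem_ball_zero_iff] at hz
  rcases eq_or_ne z 0 with rfl | hz0
  · exact ⟨0, by simp [Real.exp_nonneg], le_rfl⟩
  have him := Function.Periodic.im_invQParam_pos_of_norm_lt_one one_pos hz hz0
  obtain ⟨w, hw, he⟩ := exists_defect_eq him
  refine ⟨𝕢 1 w, ?_, ?_⟩
  · rw [mem_closedBall_zero_iff, Function.Periodic.norm_qParam, div_one]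
    refine Real.exp_le_exp.2 (mul_le_mul_of_nonpos_left hw ?_)
    linarith [Real.pi_pos]
  · rw [← defect_eq (by linarith), ← he, defect_eq him,
      Function.Periodic.qParam_right_inv one_ne_zero hz0]

lemma numer_eq_zero {q : ℂ} (hq : ‖q‖ < 1) : numer q = 0 := by
  rcases eq_or_ne q 0 with rfl | hq0
  · exact numer_zero
  have h := defectNome_eq_zero hq
  rw [defectNome_eq hq0, div_eq_zero_iff] at h
  exact h.resolve_right <| mul_ne_zero hq0 <| mul_ne_zero (pow_ne_zero _ (eulerC_ne_zero hq))
    (pow_ne_zero _ (eulerC_ne_zero (norm_pow_five_lt_one hq)))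

lemma ofReal_eulerF (q : ℝ) : (eulerF q : ℂ) = eulerC q := by
  refine (Topology.IsClosedEmbedding.map_tprod _ (g := Complex.ofRealHom)
    Complex.isUniformEmbedding_ofReal.isClosedEmbedding).trans ?_
  simp [eulerC]

lemma ofReal_eulerF_pow_five (q : ℝ) : (eulerF (q ^ 5) : ℂ) = eulerC (q ^ 5) := by
  rw [ofReal_eulerF, Complex.ofReal_pow]

lemma norm_ofReal_lt_one {q : ℝ} (hq : q ∈ Set.Ico (0 : ℝ) 1) : ‖(q : ℂ)‖ < 1 := by
  rw [Complex.norm_of_nonneg hq.1]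
  exact hq.2

lemma pow_five_mem_Ico {q : ℝ} (hq : q ∈ Set.Ico (0 : ℝ) 1) : q ^ 5 ∈ Set.Ico (0 : ℝ) 1 :=
  ⟨pow_nonneg hq.1 5, pow_lt_one₀ hq.1 hq.2 (by norm_num)⟩

lemma pos_of_continuousOn_of_ne_zero {f : ℝ → ℝ} (hf : ContinuousOn f (Set.Ico 0 1))
    (h0 : 0 < f 0) (hne : ∀ x ∈ Set.Ico (0 : ℝ) 1, f x ≠ 0) {x : ℝ}
    (hx : x ∈ Set.Ico (0 : ℝ) 1) : 0 < f x := by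
  by_contra! h
  obtain ⟨y, hy, hy0⟩ := intermediate_value_Icc' hx.1
    (hf.mono (Set.Icc_subset_Ico_right hx.2)) ⟨h, h0.le⟩
  exact hne y ⟨hy.1, hy.2.trans_lt hx.2⟩ hy0

lemma eulerF_ne_zero {q : ℝ} (hq : q ∈ Set.Ico (0 : ℝ) 1) : eulerF q ≠ 0 := by
  rw [← Complex.ofReal_ne_zero, ofReal_eulerF]
  exact eulerC_ne_zero (norm_ofReal_lt_one hq)

lemma continuousAt_eulerF {q : ℝ} (hq : q ∈ Set.Ico (0 : ℝ) 1) : ContinuousAt eulerF q := by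
  have h : eulerF = fun x : ℝ ↦ (eulerC x).re := funext fun x ↦ by
    rw [← ofReal_eulerF, Complex.ofReal_re]
  rw [h]
  exact (differentiableAt_eulerC (norm_ofReal_lt_one hq)).hasDerivAt.real_of_complex.continuousAt

lemma eulerF_pos {q : ℝ} (hq : q ∈ Set.Ico (0 : ℝ) 1) : 0 < eulerF q :=
  pos_of_continuousOn_of_ne_zero (fun _ hx ↦ (continuousAt_eulerF hx).continuousWithinAt)
    (by simp [eulerF]) (fun _ hx ↦ eulerF_ne_zero hx) hq

lemma eisen_sq {q : ℝ} (hq : q ∈ Set.Ico (0 : ℝ) 1) : eisen q ^ 2 =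
    (((eulerF q ^ 12 + 22 * q * eulerF q ^ 6 * eulerF (q ^ 5) ^ 6 +
      125 * q ^ 2 * eulerF (q ^ 5) ^ 12) / (eulerF q ^ 2 * eulerF (q ^ 5) ^ 2) : ℝ) : ℂ) := by
  have h := numer_eq_zero (norm_ofReal_lt_one hq)
  have h1 := eulerC_ne_zero (norm_ofReal_lt_one hq)
  have h5 := eulerC_ne_zero (norm_pow_five_lt_one (norm_ofReal_lt_one hq))
  push_cast
  rw [ofReal_eulerF_pow_five, ofReal_eulerF,
    eq_div_iff (mul_ne_zero (pow_ne_zero _ h1) (pow_ne_zero _ h5))]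
  rw [numer] at h
  linear_combination h

lemma ofReal_re_eisen {q : ℝ} (hq : q ∈ Set.Ico (0 : ℝ) 1) : ((eisen q).re : ℂ) = eisen q := by
  have h1 := eulerF_pos hq
  have h5 := eulerF_pos (pow_five_mem_Ico hq)
  have h0 := hq.1
  set r := (eulerF q ^ 12 + 22 * q * eulerF q ^ 6 * eulerF (q ^ 5) ^ 6 +
      125 * q ^ 2 * eulerF (q ^ 5) ^ 12) / (eulerF q ^ 2 * eulerF (q ^ 5) ^ 2)
  have hr : 0 ≤ r := by positivity
  have h : eisen q ^ 2 = ((√r : ℝ) : ℂ) ^ 2 := by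
    rw [eisen_sq hq, ← Complex.ofReal_pow, Real.sq_sqrt hr]
  rcases sq_eq_sq_iff_eq_or_eq_neg.1 h with h | h <;> rw [h] <;> simp

lemma sq_re_eisen {q : ℝ} (hq : q ∈ Set.Ico (0 : ℝ) 1) : (eisen q).re ^ 2 =
    (eulerF q ^ 12 + 22 * q * eulerF q ^ 6 * eulerF (q ^ 5) ^ 6 +
      125 * q ^ 2 * eulerF (q ^ 5) ^ 12) / (eulerF q ^ 2 * eulerF (q ^ 5) ^ 2) := by
  have h := eisen_sq hq
  rw [← ofReal_re_eisen hq] at h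
  exact_mod_cast h

lemma re_eisen_pos {q : ℝ} (hq : q ∈ Set.Ico (0 : ℝ) 1) : 0 < (eisen q).re := by
  refine pos_of_continuousOn_of_ne_zero (f := fun q : ℝ ↦ (eisen q).re) (fun x hx ↦ ?_)
    (by simp [eisen_zero]) (fun x hx h ↦ ?_) hq
  · exact (differentiableAt_eisen
      (norm_ofReal_lt_one hx)).hasDerivAt.real_of_complex.continuousAt.continuousWithinAt
  · have h1 := eulerF_pos hx
    have h5 := eulerF_pos (pow_five_mem_Ico hx)
    have h0 := hx.1
    have hs := sq_re_eisen hx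
    have : 0 < (eisen x).re ^ 2 := by rw [hs]; positivity
    exact (pow_ne_zero_iff two_ne_zero).1 this.ne' h

lemma hasDerivAt_uF {q : ℝ} (hq : q ∈ Set.Ioo (0 : ℝ) 1) :
    HasDerivAt uF (-((eisen q).re * uF q / q)) q := by
  have hq' := Set.Ioo_subset_Ico_self hq
  have hu (x : ℝ) : eulerC x ^ 6 / (x * eulerC (x ^ 5) ^ 6) = (uF x : ℂ) := by
    rw [uF]
    push_cast
    rw [ofReal_eulerF_pow_five, ofReal_eulerF]
  have h := (hasDerivAt_hauptmodul_nome (norm_ofReal_lt_one hq')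
    (Complex.ofReal_ne_zero.2 hq.1.ne')).real_of_complex
  simp only [hu, Complex.ofReal_re] at h
  refine h.congr_deriv ?_
  rw [← ofReal_re_eisen hq', ← Complex.ofReal_mul, ← Complex.ofReal_div, ← Complex.ofReal_neg,
    Complex.ofReal_re, Complex.ofReal_re]

lemma sqrt_one_add_sq_uF {q : ℝ} (hq : q ∈ Set.Ioo (0 : ℝ) 1) :
    √(1 + ((11 + uF q) / 2) ^ 2) =
      (eisen q).re * eulerF q / (2 * q * eulerF (q ^ 5) ^ 5) := by
  have hq' := Set.Ioo_subset_Ico_self hq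
  have h1 := eulerF_pos hq'
  have h5 := eulerF_pos (pow_five_mem_Ico hq')
  have he := re_eisen_pos hq'
  have h0 := hq.1
  rw [← Real.sqrt_sq (show 0 ≤ (eisen q).re * eulerF q / (2 * q * eulerF (q ^ 5) ^ 5) by
    positivity), div_pow (_ * _), mul_pow (eisen q).re, sq_re_eisen hq', uF]
  congr 1
  field_simp
  ring

lemma hasDerivAt_neg_arsinh_uF {q : ℝ} (hq : q ∈ Set.Ioo (0 : ℝ) 1) :
    HasDerivAt (fun q ↦ -Real.arsinh ((11 + uF q) / 2))
      (eulerF q ^ 5 / (eulerF (q ^ 5) * q)) q := by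
  have hq' := Set.Ioo_subset_Ico_self hq
  have h1 := (eulerF_pos hq').ne'
  have h5 := (eulerF_pos (pow_five_mem_Ico hq')).ne'
  have he := (re_eisen_pos hq').ne'
  have h0 := hq.1.ne'
  refine (((hasDerivAt_uF hq).const_add 11).div_const 2).arsinh.fun_neg.congr_deriv ?_
  rw [sqrt_one_add_sq_uF hq, uF, smul_eq_mul]
  field_simp

lemma continuousOn_integrand :
    ContinuousOn (fun q ↦ eulerF q ^ 5 / (eulerF (q ^ 5) * q)) (Set.Ioo 0 1) := by
  intro q hq
  have hq' := Set.Ioo_subset_Ico_self hq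
  have h5 : ContinuousAt (fun q ↦ eulerF (q ^ 5)) q :=
    (continuousAt_eulerF (pow_five_mem_Ico hq')).comp (f := fun q ↦ q ^ 5) (by fun_prop)
  exact (((continuousAt_eulerF hq').pow 5).div (h5.mul continuousAt_id)
    (mul_ne_zero (eulerF_ne_zero (pow_five_mem_Ico hq')) hq.1.ne')).continuousWithinAt

end LevelFive

theorem integral_f5_over_f5q (a b : ℝ) (ha : 0 < a) (hab : a ≤ b) (hb : b < 1) :
    ∫ q in a..b, eulerF q ^ 5 / (eulerF (q ^ 5) * q) =
      Real.arsinh ((11 + uF a) / 2) - Real.arsinh ((11 + uF b) / 2) := by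
  have hsub : Set.uIcc a b ⊆ Set.Ioo 0 1 := by
    rw [Set.uIcc_of_le hab]
    exact Set.Icc_subset_Ioo ha hb
  rw [intervalIntegral.integral_eq_sub_of_hasDerivAt
    (fun q hq ↦ LevelFive.hasDerivAt_neg_arsinh_uF (hsub hq))
    (LevelFive.continuousOn_integrand.mono hsub).intervalIntegrable]
  ring
end

section
/- ∫_0^1 f(-q^5)^3 · f(-q) · q^{-1/3} dq = (2π/(11^{2/3}·√3)) · ₂F₁(1/3, 5/6; 1; -4/121). -/
open MeasureTheory Real

/-- Gauss hypergeometric series `₂F₁(a, b; c; z)`. -/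
noncomputable def hyp2F1 (a b c z : ℝ) : ℝ :=
  ∑' n : ℕ, ((ascPochhammer ℝ n).eval a * (ascPochhammer ℝ n).eval b /
    (ascPochhammer ℝ n).eval c) * z ^ n / n.factorial

section ModularIdentity

open Complex hiding eta
open ModularForm MatrixGroups Filter
open UpperHalfPlane hiding I
open scoped Topology

local notation "ℍₒ" => upperHalfPlaneSet

theorem eta_pow_moebius {a b c d : ℤ} (hdet : a * d - b * c = 1) {z : ℂ} (hz : z ∈ ℍₒ) :
    (a * z + b) / (c * z + d) ∈ ℍₒ ∧
      eta ((a * z + b) / (c * z + d)) ^ 24 = (c * z + d) ^ 12 * eta z ^ 24 := by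
  let γ : SL(2, ℤ) := ⟨!![a, b; c, d], by simpa [Matrix.det_fin_two] using hdet⟩
  let τ : ℍ := ⟨z, hz⟩
  have hcoe : ((γ • τ : ℍ) : ℂ) = (a * z + b) / (c * z + d) := by
    rw [UpperHalfPlane.specialLinearGroup_apply]
    simp [γ, τ]
  have h := congrFun (SlashInvariantForm.slash_action_generators_SL2Z
    discriminant_S_invariant discriminant_T_invariant γ) τ
  rw [SL_slash_apply] at h
  have hd : denom γ τ = c * z + d := by
    simpa [γ, τ] using ModularGroup.denom_apply γ τ
  have hd0 := denom_ne_zero (γ : GL (Fin 2) ℝ) τ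
  rw [hd] at h hd0
  simp only [discriminant, hcoe] at h
  refine ⟨hcoe ▸ (γ • τ).2, ?_⟩
  rw [zpow_neg, mul_inv_eq_iff_eq_mul₀ (zpow_ne_zero _ hd0)] at h
  rw [h, mul_comm]
  rfl

theorem eqOn_of_pow_eq {f g : ℂ → ℂ} {n : ℕ} (hn : n ≠ 0)
    (hf : ContinuousOn f ℍₒ) (hg : ContinuousOn g ℍₒ) (hg0 : ∀ z ∈ ℍₒ, g z ≠ 0)
    (h : ∀ z ∈ ℍₒ, f z ^ n = g z ^ n) {z₀ : ℂ} (hz₀ : z₀ ∈ ℍₒ) (h₀ : f z₀ = g z₀) :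
    ∀ z ∈ ℍₒ, f z = g z := by
  have hpre : IsPreconnected ℍₒ := Convex.isPreconnected (convex_halfSpace_im_gt 0)
  have hfin : {w : ℂ | w ^ n = 1}.Finite := by
    refine (Polynomial.nthRoots n (1 : ℂ)).toFinset.finite_toSet.subset fun w hw ↦ ?_
    simpa [Polynomial.mem_nthRoots (Nat.pos_of_ne_zero hn)] using hw
  intro z hz
  have := hpre.constant_of_mapsTo (f := fun z ↦ f z / g z) (T := {w : ℂ | w ^ n = 1})
    hfin.isDiscrete (hf.div hg hg0) (fun w hw ↦ by
      simp [div_pow, h w hw, div_self (pow_ne_zero n (hg0 w hw))]) hz hz₀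
  simp only [h₀, div_self (hg0 z₀ hz₀)] at this
  exact (div_eq_one_iff_eq (hg0 z hz)).1 this

/-- The Hauptmodul `(η(5z)/η(z))⁶` of `Γ₀(5)`. -/
noncomputable def hauptmodulFive (z : ℂ) : ℂ := (eta (5 * z) / eta z) ^ 6

/-- The weight four eta quotient `(η(z)η(5z))⁴` of level `5`. -/
noncomputable def etaProductFive (z : ℂ) : ℂ := (eta z * eta (5 * z)) ^ 4

/-- Euler's product as a function of a complex variable. -/
noncomputable def eulerC (q : ℂ) : ℂ := ∏' n : ℕ, (1 - q ^ (n + 1))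

theorem eulerC_ofReal {q : ℝ} (hq : |q| < 1) : eulerC q = eulerF q := by
  have hm : Multipliable fun n : ℕ ↦ 1 - q ^ (n + 1) := by
    apply multipliable_one_add_of_summable (f := fun n ↦ -q ^ (n + 1))
    simpa using (summable_nat_add_iff 1).mpr (summable_geometric_of_lt_one (abs_nonneg _) hq)
  have := hm.map_tprod Complex.ofRealHom Complex.continuous_ofReal
  simpa [eulerF, eulerC] using this.symm

theorem eta_eq (z : ℂ) :
    eta z = cexp (2 * π * I * z / 24) * eulerC (cexp (2 * π * I * z)) := by
  simp only [eta, eulerC, eta_q_eq_pow, Function.Periodic.qParam]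
  push_cast
  rfl

theorem cexp_five_mul (z : ℂ) : cexp (2 * π * I * (5 * z)) = cexp (2 * π * I * z) ^ 5 := by
  rw [← Complex.exp_nat_mul]
  congr 1
  push_cast
  ring

theorem hauptmodulFive_eq (z : ℂ) :
    hauptmodulFive z = cexp (2 * π * I * z) *
      (eulerC (cexp (2 * π * I * z) ^ 5) / eulerC (cexp (2 * π * I * z))) ^ 6 := by
  rw [hauptmodulFive, eta_eq, eta_eq, cexp_five_mul, mul_div_mul_comm, mul_pow,
    ← Complex.exp_sub, ← Complex.exp_nat_mul]
  congr 2
  push_cast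
  ring

theorem etaProductFive_eq (z : ℂ) :
    etaProductFive z = cexp (2 * π * I * z) *
      (eulerC (cexp (2 * π * I * z)) * eulerC (cexp (2 * π * I * z) ^ 5)) ^ 4 := by
  rw [etaProductFive, eta_eq, eta_eq, cexp_five_mul, mul_mul_mul_comm, mul_pow,
    ← Complex.exp_add, ← Complex.exp_nat_mul]
  congr 2
  push_cast
  ring

theorem mem_ne_zero {z : ℂ} (hz : z ∈ ℍₒ) : z ≠ 0 := fun h ↦ by simp [h] at hz

theorem five_mul_mem {z : ℂ} (hz : z ∈ ℍₒ) : 5 * z ∈ ℍₒ := by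
  have : 0 < z.im := hz
  show 0 < (5 * z).im
  simpa using this

theorem differentiableAt_hauptmodulFive {z : ℂ} (hz : z ∈ ℍₒ) :
    DifferentiableAt ℂ hauptmodulFive z := by
  have h := differentiableAt_eta_of_mem_upperHalfPlaneSet hz
  have h5 : DifferentiableAt ℂ (fun z ↦ eta (5 * z)) z :=
    (differentiableAt_eta_of_mem_upperHalfPlaneSet (five_mul_mem hz)).fun_comp' z (by fun_prop)
  exact (h5.fun_div h (eta_ne_zero hz)).fun_pow 6

theorem differentiableAt_etaProductFive {z : ℂ} (hz : z ∈ ℍₒ) :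
    DifferentiableAt ℂ etaProductFive z := by
  have h := differentiableAt_eta_of_mem_upperHalfPlaneSet hz
  have h5 : DifferentiableAt ℂ (fun z ↦ eta (5 * z)) z :=
    (differentiableAt_eta_of_mem_upperHalfPlaneSet (five_mul_mem hz)).fun_comp' z (by fun_prop)
  exact (h.fun_mul h5).fun_pow 4

theorem hauptmodulFive_ne_zero {z : ℂ} (hz : z ∈ ℍₒ) : hauptmodulFive z ≠ 0 :=
  pow_ne_zero _ (div_ne_zero (eta_ne_zero (five_mul_mem hz)) (eta_ne_zero hz))

theorem etaProductFive_ne_zero {z : ℂ} (hz : z ∈ ℍₒ) : etaProductFive z ≠ 0 :=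
  pow_ne_zero _ (mul_ne_zero (eta_ne_zero hz) (eta_ne_zero (five_mul_mem hz)))

theorem hauptmodulFive_pow (z : ℂ) :
    hauptmodulFive z ^ 4 = eta (5 * z) ^ 24 / eta z ^ 24 := by
  rw [hauptmodulFive, ← pow_mul, div_pow]

theorem etaProductFive_pow (z : ℂ) :
    etaProductFive z ^ 6 = eta z ^ 24 * eta (5 * z) ^ 24 := by
  rw [etaProductFive, ← pow_mul, mul_pow]

theorem fricke_mem {z : ℂ} (hz : z ∈ ℍₒ) : -1 / (5 * z) ∈ ℍₒ := by
  simpa using (eta_pow_moebius (a := 0) (b := -1) (c := 1) (d := 0) (by simp)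
    (five_mul_mem hz)).1

theorem eta_fricke {z : ℂ} (hz : z ∈ ℍₒ) :
    eta (-1 / (5 * z)) ^ 24 = (5 * z) ^ 12 * eta (5 * z) ^ 24 := by
  simpa using (eta_pow_moebius (a := 0) (b := -1) (c := 1) (d := 0) (by simp)
    (five_mul_mem hz)).2

theorem eta_five_fricke {z : ℂ} (hz : z ∈ ℍₒ) :
    eta (5 * (-1 / (5 * z))) ^ 24 = z ^ 12 * eta z ^ 24 := by
  have := (eta_pow_moebius (a := 0) (b := -1) (c := 1) (d := 0) (by simp) hz).2
  have hz0 := mem_ne_zero hz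
  simp only [Int.cast_zero, zero_mul, Int.cast_neg, Int.cast_one, zero_add, one_mul,
    add_zero] at this
  rw [← this]
  congr 2
  field_simp

theorem fricke_fixed : ∃ t : ℝ, 0 < t ∧ 5 * (t * I) ^ 2 = -1 := by
  refine ⟨(√5)⁻¹, by positivity, ?_⟩
  rw [mul_pow, I_sq, ← ofReal_pow, inv_pow, Real.sq_sqrt (by norm_num)]
  norm_num

theorem ofReal_mul_I_mem {t : ℝ} (ht : 0 < t) : (t * I : ℂ) ∈ ℍₒ := by
  show 0 < (t * I : ℂ).im
  simpa using ht

theorem cexp_ofReal_mul_I (t : ℝ) :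
    cexp (2 * π * I * (t * I)) = (Real.exp (-(2 * π * t)) : ℝ) := by
  rw [Complex.ofReal_exp]
  congr 1
  push_cast
  linear_combination (2 * π * t : ℂ) * I_sq

theorem hauptmodulFive_ofReal_mul_I {t : ℝ} (ht : 0 < t) :
    hauptmodulFive (t * I) = ((Real.exp (-(2 * π * t)) *
      (eulerF (Real.exp (-(2 * π * t)) ^ 5) / eulerF (Real.exp (-(2 * π * t)))) ^ 6 : ℝ) : ℂ) := by
  have h : Real.exp (-(2 * π * t)) < 1 := by simp; positivity
  have h0 := Real.exp_pos (-(2 * π * t))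
  rw [hauptmodulFive_eq, cexp_ofReal_mul_I, ← ofReal_pow,
    eulerC_ofReal (by
      rw [abs_of_pos (pow_pos h0 5)]; exact pow_lt_one₀ h0.le h (by norm_num)),
    eulerC_ofReal (by rwa [abs_of_pos h0])]
  push_cast
  rfl

theorem etaProductFive_ofReal_mul_I {t : ℝ} (ht : 0 < t) :
    etaProductFive (t * I) = ((Real.exp (-(2 * π * t)) *
      (eulerF (Real.exp (-(2 * π * t))) * eulerF (Real.exp (-(2 * π * t)) ^ 5)) ^ 4 : ℝ) : ℂ) := by
  have h : Real.exp (-(2 * π * t)) < 1 := by simp; positivity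
  have h0 := Real.exp_pos (-(2 * π * t))
  rw [etaProductFive_eq, cexp_ofReal_mul_I, ← ofReal_pow,
    eulerC_ofReal (by rwa [abs_of_pos h0]), eulerC_ofReal (by
      rw [abs_of_pos (pow_pos h0 5)]; exact pow_lt_one₀ h0.le h (by norm_num))]
  push_cast
  rfl

theorem elliptic_mem {z : ℂ} (hz : z ∈ ℍₒ) : (2 * z - 1) / (5 * z - 2) ∈ ℍₒ := by
  simpa [sub_eq_add_neg] using (eta_pow_moebius (a := 2) (b := -1) (c := 5) (d := -2) (by simp)
    hz).1

theorem elliptic_denom_ne_zero {z : ℂ} (hz : z ∈ ℍₒ) : 5 * z - 2 ≠ 0 := by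
  intro h
  have h1 : 0 < z.im := hz
  have := congrArg Complex.im h
  simp at this
  linarith

theorem eta_elliptic {z : ℂ} (hz : z ∈ ℍₒ) :
    eta ((2 * z - 1) / (5 * z - 2)) ^ 24 = (5 * z - 2) ^ 12 * eta z ^ 24 := by
  simpa [sub_eq_add_neg] using (eta_pow_moebius (a := 2) (b := -1) (c := 5) (d := -2) (by simp)
    hz).2

theorem eta_five_elliptic {z : ℂ} (hz : z ∈ ℍₒ) :
    eta (5 * ((2 * z - 1) / (5 * z - 2))) ^ 24 = (5 * z - 2) ^ 12 * eta (5 * z) ^ 24 := by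
  have := (eta_pow_moebius (a := 2) (b := -5) (c := 1) (d := -2) (by simp)
    (five_mul_mem hz)).2
  convert this using 2
  · congr 1
    push_cast
    ring
  · push_cast
    ring

theorem elliptic_fixed : ∃ z ∈ ℍₒ, (2 * z - 1) / (5 * z - 2) = z ∧ (5 * z - 2) = I := by
  have h : (2 + I) / 5 ∈ ℍₒ := by
    show 0 < ((2 + I) / 5).im
    simp
  refine ⟨(2 + I) / 5, h, ?_, by ring⟩
  rw [div_eq_iff (elliptic_denom_ne_zero h)]
  linear_combination (-1 / 5 : ℂ) * I_sq

theorem hauptmodulFive_elliptic {z : ℂ} (hz : z ∈ ℍₒ) :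
    hauptmodulFive ((2 * z - 1) / (5 * z - 2)) = hauptmodulFive z := by
  obtain ⟨w, hw, hw1, -⟩ := elliptic_fixed
  refine eqOn_of_pow_eq (f := fun z ↦ hauptmodulFive ((2 * z - 1) / (5 * z - 2))) (n := 4)
    (by norm_num) ?_ ?_ (fun z ↦ hauptmodulFive_ne_zero) ?_ hw (by simp only [hw1]) z hz
  · intro z hz
    refine ContinuousAt.continuousWithinAt (ContinuousAt.comp (g := hauptmodulFive)
      (differentiableAt_hauptmodulFive (elliptic_mem hz)).continuousAt ?_)
    exact ContinuousAt.div (by fun_prop) (by fun_prop) (elliptic_denom_ne_zero hz)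
  · exact fun z hz ↦ (differentiableAt_hauptmodulFive hz).continuousAt.continuousWithinAt
  · intro z hz
    rw [hauptmodulFive_pow, hauptmodulFive_pow, eta_elliptic hz, eta_five_elliptic hz,
      mul_div_mul_left _ _ (pow_ne_zero _ (elliptic_denom_ne_zero hz))]

theorem etaProductFive_elliptic {z : ℂ} (hz : z ∈ ℍₒ) :
    etaProductFive ((2 * z - 1) / (5 * z - 2)) = (5 * z - 2) ^ 4 * etaProductFive z := by
  obtain ⟨w, hw, hw1, hw2⟩ := elliptic_fixed
  refine eqOn_of_pow_eq (f := fun z ↦ etaProductFive ((2 * z - 1) / (5 * z - 2)))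
    (g := fun z ↦ (5 * z - 2) ^ 4 * etaProductFive z) (n := 6)
    (by norm_num) ?_ ?_ (fun z hz ↦ mul_ne_zero (pow_ne_zero _ (elliptic_denom_ne_zero hz))
      (etaProductFive_ne_zero hz)) ?_ hw (by simp only [hw1]; rw [hw2, I_pow_four, one_mul]) z hz
  · intro z hz
    refine ContinuousAt.continuousWithinAt (ContinuousAt.comp (g := etaProductFive)
      (differentiableAt_etaProductFive (elliptic_mem hz)).continuousAt ?_)
    exact ContinuousAt.div (by fun_prop) (by fun_prop) (elliptic_denom_ne_zero hz)
  · exact fun z hz ↦ ContinuousAt.continuousWithinAt (ContinuousAt.mul (by fun_prop)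
      (differentiableAt_etaProductFive hz).continuousAt)
  · intro z hz
    rw [mul_pow, etaProductFive_pow, etaProductFive_pow, eta_elliptic hz, eta_five_elliptic hz]
    ring

theorem hauptmodulFive_fricke {z : ℂ} (hz : z ∈ ℍₒ) :
    hauptmodulFive (-1 / (5 * z)) * hauptmodulFive z = 1 / 125 := by
  obtain ⟨t, ht, hw1⟩ := fricke_fixed
  have hw := ofReal_mul_I_mem ht
  have hpow : ∀ z ∈ ℍₒ, (hauptmodulFive (-1 / (5 * z)) * hauptmodulFive z) ^ 4 =
      (1 / 125 : ℂ) ^ 4 := by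
    intro z hz
    rw [mul_pow, hauptmodulFive_pow, hauptmodulFive_pow, eta_fricke hz, eta_five_fricke hz]
    have := eta_ne_zero hz
    have := eta_ne_zero (five_mul_mem hz)
    have := mem_ne_zero hz
    have h5 : (5 * z) ^ 12 ≠ 0 := pow_ne_zero _ (mem_ne_zero (five_mul_mem hz))
    generalize eta (5 * z) = x at *
    field_simp
    norm_num
  have h1 : -1 / (5 * (t * I : ℂ)) = t * I := by
    rw [div_eq_iff (mem_ne_zero (five_mul_mem hw))]
    linear_combination -hw1
  refine eqOn_of_pow_eq (f := fun z ↦ hauptmodulFive (-1 / (5 * z)) * hauptmodulFive z)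
    (g := fun _ ↦ 1 / 125) (n := 4) (by norm_num) ?_ (by fun_prop) (by norm_num) hpow hw ?_ z hz
  · intro z hz
    refine ContinuousAt.continuousWithinAt (ContinuousAt.mul (ContinuousAt.comp
      (g := hauptmodulFive) (differentiableAt_hauptmodulFive (fricke_mem hz)).continuousAt ?_)
      (differentiableAt_hauptmodulFive hz).continuousAt)
    exact ContinuousAt.div (by fun_prop) (by fun_prop) (mem_ne_zero (five_mul_mem hz))
  · have h2 := hpow _ hw
    obtain ⟨r, hr⟩ : ∃ r : ℝ, hauptmodulFive (t * I) = r :=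
      ⟨_, hauptmodulFive_ofReal_mul_I ht⟩
    simp only [h1, hr] at h2 ⊢
    have h3 : (r * r) ^ 4 = (1 / 125 : ℝ) ^ 4 := by
      apply ofReal_injective
      push_cast at h2 ⊢
      exact h2
    rw [pow_left_inj₀ (mul_self_nonneg r) (by norm_num) (by norm_num)] at h3
    rw [← ofReal_mul, h3]
    push_cast
    rfl

theorem etaProductFive_fricke {z : ℂ} (hz : z ∈ ℍₒ) :
    etaProductFive (-1 / (5 * z)) = 25 * z ^ 4 * etaProductFive z := by
  obtain ⟨t, ht, hw1⟩ := fricke_fixed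
  have hw := ofReal_mul_I_mem ht
  set w : ℂ := t * I
  refine eqOn_of_pow_eq (f := fun z ↦ etaProductFive (-1 / (5 * z)))
    (g := fun z ↦ 25 * z ^ 4 * etaProductFive z) (n := 6)
    (by norm_num) ?_ ?_ (fun z hz ↦ mul_ne_zero (mul_ne_zero (by norm_num)
      (pow_ne_zero _ (mem_ne_zero hz))) (etaProductFive_ne_zero hz)) ?_ hw ?_ z hz
  · intro z hz
    refine ContinuousAt.continuousWithinAt (ContinuousAt.comp (g := etaProductFive)
      (differentiableAt_etaProductFive (fricke_mem hz)).continuousAt ?_)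
    exact ContinuousAt.div (by fun_prop) (by fun_prop) (mem_ne_zero (five_mul_mem hz))
  · exact fun z hz ↦ ContinuousAt.continuousWithinAt (ContinuousAt.mul (by fun_prop)
      (differentiableAt_etaProductFive hz).continuousAt)
  · intro z hz
    rw [mul_pow, etaProductFive_pow, etaProductFive_pow, eta_fricke hz, eta_five_fricke hz]
    ring
  · have h1 : -1 / (5 * w) = w := by
      rw [div_eq_iff (mem_ne_zero (five_mul_mem hw))]
      linear_combination -hw1
    have h2 : 25 * w ^ 4 = 1 := by linear_combination (5 * w ^ 2 - 1) * hw1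
    simp only [h1, h2, one_mul]

theorem hauptmodulFive_add_one (z : ℂ) : hauptmodulFive (z + 1) = hauptmodulFive z := by
  simp only [hauptmodulFive_eq, mul_add, mul_one, Complex.exp_add, Complex.exp_two_pi_mul_I]

theorem etaProductFive_add_one (z : ℂ) : etaProductFive (z + 1) = etaProductFive z := by
  simp only [etaProductFive_eq, mul_add, mul_one, Complex.exp_add, Complex.exp_two_pi_mul_I]

/-- The normalised logarithmic derivative of `hauptmodulFive`, which has weight two. -/
noncomputable def weightTwoFive (z : ℂ) : ℂ := logDeriv hauptmodulFive z / (2 * π * I)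

theorem isOpen_upper : IsOpen ℍₒ := isOpen_upperHalfPlaneSet

theorem analyticAt_hauptmodulFive {z : ℂ} (hz : z ∈ ℍₒ) : AnalyticAt ℂ hauptmodulFive z :=
  DifferentiableOn.analyticAt (s := ℍₒ)
    (fun _ hw ↦ (differentiableAt_hauptmodulFive hw).differentiableWithinAt)
    (isOpen_upper.mem_nhds hz)

theorem differentiableAt_weightTwoFive {z : ℂ} (hz : z ∈ ℍₒ) :
    DifferentiableAt ℂ weightTwoFive z :=
  ((analyticAt_hauptmodulFive hz).deriv.differentiableAt.fun_div
    (differentiableAt_hauptmodulFive hz) (hauptmodulFive_ne_zero hz)).div_const _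

theorem weightTwoFive_add_one (z : ℂ) : weightTwoFive (z + 1) = weightTwoFive z := by
  have : deriv hauptmodulFive (z + 1) = deriv hauptmodulFive z := by
    rw [← deriv_comp_add_const]
    simp only [hauptmodulFive_add_one]
  simp only [weightTwoFive, logDeriv_apply, hauptmodulFive_add_one, this]

theorem weightTwoFive_elliptic {z : ℂ} (hz : z ∈ ℍₒ) :
    weightTwoFive ((2 * z - 1) / (5 * z - 2)) = (5 * z - 2) ^ 2 * weightTwoFive z := by
  have hd := elliptic_denom_ne_zero hz
  have h1 : HasDerivAt (fun z : ℂ ↦ (2 * z - 1) / (5 * z - 2)) (1 / (5 * z - 2) ^ 2) z := by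
    have hn : HasDerivAt (fun z : ℂ ↦ 2 * z - 1) (2 * 1) z :=
      ((hasDerivAt_id z).const_mul 2).sub_const 1
    have hm : HasDerivAt (fun z : ℂ ↦ 5 * z - 2) (5 * 1) z :=
      ((hasDerivAt_id z).const_mul 5).sub_const 2
    refine (hn.fun_div hm hd).congr_deriv ?_
    ring
  have h2 := ((differentiableAt_hauptmodulFive (elliptic_mem hz)).hasDerivAt.comp z h1).deriv
  have h3 : deriv (hauptmodulFive ∘ fun z : ℂ ↦ (2 * z - 1) / (5 * z - 2)) z =
      deriv hauptmodulFive z := by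
    apply Filter.EventuallyEq.deriv_eq
    filter_upwards [isOpen_upper.mem_nhds hz] with w hw
    exact hauptmodulFive_elliptic hw
  rw [h3] at h2
  simp only [weightTwoFive, logDeriv_apply, hauptmodulFive_elliptic hz, h2]
  generalize 5 * z - 2 = d at *
  generalize deriv hauptmodulFive _ = b at *
  field_simp

theorem weightTwoFive_fricke {z : ℂ} (hz : z ∈ ℍₒ) :
    weightTwoFive (-1 / (5 * z)) = -(5 * z ^ 2 * weightTwoFive z) := by
  have hd := mem_ne_zero hz
  have h1 : HasDerivAt (fun z : ℂ ↦ -1 / (5 * z)) (1 / (5 * z ^ 2)) z := by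
    have hm : HasDerivAt (fun z : ℂ ↦ 5 * z) (5 * 1) z := (hasDerivAt_id z).const_mul 5
    refine ((hasDerivAt_const z (-1 : ℂ)).fun_div hm (mem_ne_zero (five_mul_mem hz))).congr_deriv ?_
    field_simp
    ring
  have hu := (differentiableAt_hauptmodulFive hz).hasDerivAt
  have h2 := (((differentiableAt_hauptmodulFive (fricke_mem hz)).hasDerivAt.comp z h1).mul hu).deriv
  have h3 : deriv ((hauptmodulFive ∘ fun z : ℂ ↦ -1 / (5 * z)) * hauptmodulFive) z = 0 := by
    rw [← deriv_const z (1 / 125 : ℂ)]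
    apply Filter.EventuallyEq.deriv_eq
    filter_upwards [isOpen_upper.mem_nhds hz] with w hw
    exact hauptmodulFive_fricke hw
  rw [h3] at h2
  have hu0 := hauptmodulFive_ne_zero hz
  have hw0 := hauptmodulFive_ne_zero (fricke_mem hz)
  simp only [weightTwoFive, logDeriv_apply, Function.comp_apply] at h2 ⊢
  generalize hauptmodulFive (-1 / (5 * z)) = a at *
  generalize deriv hauptmodulFive (-1 / (5 * z)) = b at *
  field_simp at h2 ⊢
  linear_combination -h2

/-- The weight zero form of level `5` whose vanishing is the differential equation satisfied by
`hauptmodulFive`. -/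
noncomputable def defectFive (z : ℂ) : ℂ :=
  weightTwoFive z ^ 2 / etaProductFive z - 1 / hauptmodulFive z - 22 - 125 * hauptmodulFive z

theorem differentiableAt_defectFive {z : ℂ} (hz : z ∈ ℍₒ) : DifferentiableAt ℂ defectFive z := by
  have h1 := differentiableAt_hauptmodulFive hz
  exact (((((differentiableAt_weightTwoFive hz).fun_pow 2).fun_div
    (differentiableAt_etaProductFive hz) (etaProductFive_ne_zero hz)).fun_sub
    ((differentiableAt_const 1).fun_div h1 (hauptmodulFive_ne_zero hz))).sub_const 22).fun_sub
    (h1.const_mul 125)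

theorem defectFive_add_one (z : ℂ) : defectFive (z + 1) = defectFive z := by
  simp only [defectFive, weightTwoFive_add_one, etaProductFive_add_one, hauptmodulFive_add_one]

theorem defectFive_elliptic {z : ℂ} (hz : z ∈ ℍₒ) :
    defectFive ((2 * z - 1) / (5 * z - 2)) = defectFive z := by
  have hd := elliptic_denom_ne_zero hz
  simp only [defectFive, weightTwoFive_elliptic hz, etaProductFive_elliptic hz,
    hauptmodulFive_elliptic hz]
  rw [mul_pow, ← pow_mul, mul_div_mul_left _ _ (pow_ne_zero _ hd)]

theorem defectFive_fricke {z : ℂ} (hz : z ∈ ℍₒ) :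
    defectFive (-1 / (5 * z)) = defectFive z := by
  have hd := mem_ne_zero hz
  have hD := etaProductFive_ne_zero hz
  have hu0 := hauptmodulFive_ne_zero hz
  have hu : hauptmodulFive (-1 / (5 * z)) = 1 / (125 * hauptmodulFive z) := by
    rw [eq_div_iff (by simpa using hu0)]
    linear_combination 125 * hauptmodulFive_fricke hz
  simp only [defectFive, weightTwoFive_fricke hz, etaProductFive_fricke hz, hu]
  field_simp
  ring

theorem eulerC_ne_zero {q : ℂ} (hq : ‖q‖ < 1) : eulerC q ≠ 0 := by
  refine tprod_one_add_ne_zero_of_summable (f := fun n ↦ -q ^ (n + 1)) (fun n h ↦ ?_) ?_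
  · have h1 : q ^ (n + 1) = 1 := by linear_combination -h
    have h2 : ‖q‖ ^ (n + 1) = 1 := by rw [← norm_pow, h1, norm_one]
    exact (pow_lt_one₀ (norm_nonneg _) hq (by simp)).ne h2
  · simpa using (summable_nat_add_iff 1).mpr (summable_geometric_of_lt_one (norm_nonneg q) hq)

theorem differentiableAt_eulerC {q : ℂ} (hq : ‖q‖ < 1) : DifferentiableAt ℂ eulerC q :=
  differentiableOn_tprod_one_sub_pow.differentiableAt (Metric.isOpen_ball.mem_nhds (by simpa))

theorem eulerC_zero : eulerC 0 = 1 := by simp [eulerC]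

theorem hasDerivAt_eulerC_zero : HasDerivAt eulerC (-1) 0 := by
  have hd := (differentiableAt_eulerC (q := 0) (by simp)).hasDerivAt
  have hterm : ∀ n : ℕ, logDeriv (fun q : ℂ ↦ 1 - q ^ (n + 1)) 0 = if n = 0 then -1 else 0 := by
    intro n
    rcases eq_or_ne n 0 with rfl | hn
    · simp [logDeriv_apply]
    · simp [logDeriv_apply, hn]
  have h := logDeriv_tprod_eq_tsum (f := fun (n : ℕ) (q : ℂ) ↦ 1 - q ^ (n + 1))
    Metric.isOpen_ball (Metric.mem_ball_self one_pos) (by simp) (fun _ ↦ by fun_prop)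
    (by simp only [hterm]; exact (hasSum_ite_eq 0 (-1 : ℂ)).summable)
    multipliableLocallyUniformlyOn_one_sub_pow (by simp)
  simp only [hterm, tsum_ite_eq] at h
  have h' : deriv eulerC 0 / eulerC 0 = -1 := h
  rw [eulerC_zero, div_one] at h'
  rwa [h'] at hd

/-- The power series of `hauptmodulFive` in the nome, divided by the nome. -/
noncomputable def hauptmodulSeries (q : ℂ) : ℂ := (eulerC (q ^ 5) / eulerC q) ^ 6

theorem norm_pow_five_lt_one {q : ℂ} (hq : ‖q‖ < 1) : ‖q ^ 5‖ < 1 := by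
  rw [norm_pow]
  exact pow_lt_one₀ (norm_nonneg _) hq (by simp)

theorem differentiableAt_hauptmodulSeries {q : ℂ} (hq : ‖q‖ < 1) :
    DifferentiableAt ℂ hauptmodulSeries q := by
  have h5 : DifferentiableAt ℂ (fun q ↦ eulerC (q ^ 5)) q :=
    (differentiableAt_eulerC (norm_pow_five_lt_one hq)).fun_comp' q (by fun_prop)
  exact (h5.fun_div (differentiableAt_eulerC hq) (eulerC_ne_zero hq)).fun_pow 6

theorem hauptmodulSeries_ne_zero {q : ℂ} (hq : ‖q‖ < 1) : hauptmodulSeries q ≠ 0 :=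
  pow_ne_zero _ (div_ne_zero (eulerC_ne_zero (norm_pow_five_lt_one hq)) (eulerC_ne_zero hq))

theorem norm_cexp_lt_one {z : ℂ} (hz : z ∈ ℍₒ) : ‖cexp (2 * π * I * z)‖ < 1 := by
  simpa [Function.Periodic.qParam] using Function.Periodic.norm_qParam_lt_one (h := 1) one_pos hz

theorem hasDerivAt_hauptmodulFive {z : ℂ} (hz : z ∈ ℍₒ) :
    HasDerivAt hauptmodulFive (2 * π * I * (cexp (2 * π * I * z) *
      (hauptmodulSeries (cexp (2 * π * I * z)) +
        cexp (2 * π * I * z) * deriv hauptmodulSeries (cexp (2 * π * I * z))))) z := by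
  have he : HasDerivAt (fun z ↦ cexp (2 * π * I * z)) (cexp (2 * π * I * z) * (2 * π * I * 1)) z :=
    ((hasDerivAt_id z).const_mul _).cexp
  have hs := (differentiableAt_hauptmodulSeries (norm_cexp_lt_one hz)).hasDerivAt.comp z he
  have : hauptmodulFive = fun z ↦ cexp (2 * π * I * z) *
      (hauptmodulSeries ∘ fun z ↦ cexp (2 * π * I * z)) z := by
    ext z
    rw [hauptmodulFive_eq]
    rfl
  rw [this]
  refine (he.fun_mul hs).congr_deriv ?_
  simp only [Function.comp_apply]
  ring

theorem weightTwoFive_eq {z : ℂ} (hz : z ∈ ℍₒ) :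
    weightTwoFive z = 1 + cexp (2 * π * I * z) *
      (deriv hauptmodulSeries (cexp (2 * π * I * z)) /
        hauptmodulSeries (cexp (2 * π * I * z))) := by
  have hu : hauptmodulFive z = cexp (2 * π * I * z) * hauptmodulSeries (cexp (2 * π * I * z)) :=
    hauptmodulFive_eq z
  rw [weightTwoFive, logDeriv_apply, (hasDerivAt_hauptmodulFive hz).deriv, hu]
  have h1 := hauptmodulSeries_ne_zero (norm_cexp_lt_one hz)
  have h2 := exp_ne_zero (2 * π * I * z)
  have h3 := two_pi_I_ne_zero
  generalize hauptmodulSeries _ = a at *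
  generalize deriv hauptmodulSeries _ = b at *
  generalize cexp _ = c at *
  generalize 2 * π * I = d at *
  field_simp

theorem hasDerivAt_eulerC_pow_five_zero : HasDerivAt (fun q ↦ eulerC (q ^ 5)) 0 0 := by
  have h : HasDerivAt (fun q : ℂ ↦ q ^ 5) 0 0 := by simpa using hasDerivAt_pow 5 (0 : ℂ)
  have h0 : HasDerivAt eulerC (-1) ((0 : ℂ) ^ 5) := by simpa using hasDerivAt_eulerC_zero
  simpa using! h0.comp (0 : ℂ) h

theorem hauptmodulSeries_zero : hauptmodulSeries 0 = 1 := by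
  simp [hauptmodulSeries, eulerC_zero]

theorem hasDerivAt_hauptmodulSeries_zero : HasDerivAt hauptmodulSeries 6 0 := by
  have := (hasDerivAt_eulerC_pow_five_zero.fun_div hasDerivAt_eulerC_zero
    (by simp [eulerC_zero])).fun_pow 6
  simpa [eulerC_zero] using! this

/-- The `q`-expansion of `defectFive`, multiplied by the nome. -/
noncomputable def defectSeries (q : ℂ) : ℂ :=
  (1 + q * (deriv hauptmodulSeries q / hauptmodulSeries q)) ^ 2 / (eulerC q * eulerC (q ^ 5)) ^ 4 -
    1 / hauptmodulSeries q - 22 * q - 125 * q ^ 2 * hauptmodulSeries q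

theorem hasDerivAt_defectSeries_zero : HasDerivAt defectSeries 0 0 := by
  have hU := hasDerivAt_hauptmodulSeries_zero
  have hU0 : hauptmodulSeries 0 ≠ 0 := by simp [hauptmodulSeries_zero]
  have hdU : DifferentiableAt ℂ (deriv hauptmodulSeries) 0 := by
    have : AnalyticAt ℂ hauptmodulSeries 0 :=
      DifferentiableOn.analyticAt (s := Metric.ball 0 1)
        (fun w hw ↦ (differentiableAt_hauptmodulSeries (by simpa using hw)).differentiableWithinAt)
        (Metric.isOpen_ball.mem_nhds (by simp))
    exact this.deriv.differentiableAt
  have hL := hdU.hasDerivAt.fun_div hU hU0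
  have h1 := (((hasDerivAt_id' (0 : ℂ)).fun_mul hL).const_add 1).fun_pow 2
  have h2 := (hasDerivAt_eulerC_zero.fun_mul hasDerivAt_eulerC_pow_five_zero).fun_pow 4
  have h3 := h1.fun_div h2 (by simp [eulerC_zero])
  have h4 := (hasDerivAt_const (0 : ℂ) (1 : ℂ)).fun_div hU hU0
  have h5 := ((((hasDerivAt_id' (0 : ℂ)).fun_pow 2).const_mul 125).fun_mul hU)
  have h6 := (((h3.fun_sub h4).fun_sub ((hasDerivAt_id' (0 : ℂ)).const_mul 22)).fun_sub h5)
  refine h6.congr_deriv ?_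
  rw [hU.deriv]
  simp [eulerC_zero, hauptmodulSeries_zero]
  norm_num

theorem defectSeries_zero : defectSeries 0 = 0 := by
  simp [defectSeries, eulerC_zero, hauptmodulSeries_zero]

theorem defectFive_eq {z : ℂ} (hz : z ∈ ℍₒ) :
    defectFive z = defectSeries (cexp (2 * π * I * z)) / cexp (2 * π * I * z) := by
  have hu : hauptmodulFive z = cexp (2 * π * I * z) * hauptmodulSeries (cexp (2 * π * I * z)) :=
    hauptmodulFive_eq z
  rw [defectFive, defectSeries, weightTwoFive_eq hz, etaProductFive_eq, hu]
  have h1 := hauptmodulSeries_ne_zero (norm_cexp_lt_one hz)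
  have h2 := exp_ne_zero (2 * π * I * z)
  have h3 := eulerC_ne_zero (norm_cexp_lt_one hz)
  have h4 := eulerC_ne_zero (norm_pow_five_lt_one (norm_cexp_lt_one hz))
  generalize hauptmodulSeries _ = a at *
  generalize deriv hauptmodulSeries _ = b at *
  generalize cexp _ = c at *
  field_simp

theorem tendsto_defectFive : Tendsto defectFive (comap Complex.im atTop) (𝓝 0) := by
  have h := hasDerivAt_defectSeries_zero.tendsto_slope.comp
    (Function.Periodic.qParam_tendsto (h := 1) one_pos)
  refine h.congr' ?_
  filter_upwards [preimage_mem_comap (eventually_gt_atTop (0 : ℝ))] with z hz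
  rw [defectFive_eq hz]
  simp [slope_def_field, defectSeries_zero, Function.Periodic.qParam]

theorem defectFive_elliptic' {z : ℂ} (hz : z ∈ ℍₒ) :
    defectFive ((-2 * z - 1) / (5 * z + 2)) = defectFive z := by
  rw [← defectFive_fricke hz, ← defectFive_elliptic (fricke_mem hz),
    ← defectFive_fricke (elliptic_mem (fricke_mem hz))]
  congr 1
  have hz0 := mem_ne_zero hz
  have h1 := elliptic_denom_ne_zero (fricke_mem hz)
  have h2 := mem_ne_zero (five_mul_mem (elliptic_mem (fricke_mem hz)))
  have h3 : 5 * z + 2 ≠ 0 := by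
    intro h
    have := congrArg Complex.im h
    have hz' : 0 < z.im := hz
    simp at this
    exact hz'.ne' this
  have h4 : 2 * z + 1 ≠ 0 := by
    intro h
    have := congrArg Complex.im h
    have hz' : 0 < z.im := hz
    simp at this
    exact hz'.ne' this
  have h5 : 5 * (-1 / (5 * z)) - 2 = -(2 * z + 1) / z := by
    field_simp
    ring
  have h6 : 2 * (-1 / (5 * z)) - 1 = -(5 * z + 2) / (5 * z) := by
    field_simp
    ring
  rw [h5, h6]
  field_simp
  ring

/-- The product of `defectFive` over the cosets of `Γ₀(5)`. -/
noncomputable def defectNorm (z : ℂ) : ℂ :=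
  defectFive z * (defectFive ((z - 2) / 5) * defectFive ((z - 1) / 5) * defectFive (z / 5) *
    defectFive ((z + 1) / 5) * defectFive ((z + 2) / 5))

theorem defectNorm_add_one (z : ℂ) : defectNorm (z + 1) = defectNorm z := by
  have h1 : (z + 1 - 2) / 5 = (z - 1) / 5 := by ring
  have h2 : (z + 1 - 1) / 5 = z / 5 := by ring
  have h3 : (z + 1 + 1) / 5 = (z + 2) / 5 := by ring
  have h4 : (z + 1 + 2) / 5 = (z - 2) / 5 + 1 := by ring
  rw [defectNorm, defectNorm, h1, h2, h3, h4, defectFive_add_one, defectFive_add_one]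
  ring

theorem add_div_five_mem {z : ℂ} (hz : z ∈ ℍₒ) (x : ℝ) : (z + x) / 5 ∈ ℍₒ := by
  have hz' : 0 < z.im := hz
  change 0 < ((z + x) / 5).im
  have : ((z + x) / 5).im = z.im / 5 := by
    rw [show (z + x) / 5 = (z + x) / ((5 : ℝ) : ℂ) by simp, Complex.div_ofReal_im]
    simp
  rw [this]
  positivity

theorem sub_one_mem {z : ℂ} (hz : z ∈ ℍₒ) : z - 1 ∈ ℍₒ := by
  have hz' : 0 < z.im := hz
  simpa [upperHalfPlaneSet] using hz'

theorem neg_inv_mem {z : ℂ} (hz : z ∈ ℍₒ) : -1 / z ∈ ℍₒ := by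
  simpa using (eta_pow_moebius (a := 0) (b := -1) (c := 1) (d := 0) (by simp) hz).1

theorem defectFive_cusp_swap {z : ℂ} (hz : z ∈ ℍₒ) :
    defectFive ((-1 / z + 1) / 5) = defectFive ((z - 1) / 5) := by
  have hz0 := mem_ne_zero hz
  have hz1 := mem_ne_zero (sub_one_mem hz)
  have h1 := defectFive_fricke (z := (z + (-1 : ℝ)) / 5) (add_div_five_mem hz (-1))
  have e1 : (z + (-1 : ℝ)) / 5 = (z - 1) / 5 := by push_cast; ring
  have h2 := defectFive_fricke (add_div_five_mem (neg_inv_mem hz) 1)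
  have e2 : -1 / (5 * ((-1 / z + (1 : ℝ)) / 5)) + 1 = -1 / (5 * ((z - 1) / 5)) := by
    have : -1 / z + ((1 : ℝ) : ℂ) = (z - 1) / z := by push_cast; field_simp; ring
    rw [this]
    field_simp
    ring
  rw [e1] at h1
  rw [← h1, ← e2, defectFive_add_one, h2]
  simp

theorem defectNorm_neg_inv {z : ℂ} (hz : z ∈ ℍₒ) : defectNorm (-1 / z) = defectNorm z := by
  have hz0 := mem_ne_zero hz
  have c0 : defectFive (-1 / z) = defectFive (z / 5) := by
    have := defectFive_fricke (add_div_five_mem hz 0)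
    simp only [ofReal_zero, add_zero] at this
    rw [← this]
    congr 1
    field_simp
  have c1 : defectFive (-1 / z / 5) = defectFive z := by
    rw [← defectFive_fricke hz]
    congr 1
    field_simp
  have c2 : defectFive ((-1 / z + 2) / 5) = defectFive ((z + 2) / 5) := by
    have := defectFive_elliptic (add_div_five_mem hz 2)
    simp only [ofReal_ofNat] at this
    rw [← this]
    congr 1
    rw [show 5 * ((z + 2) / 5) - 2 = z by ring]
    field_simp
    ring
  have c3 : defectFive ((-1 / z - 2) / 5) = defectFive ((z - 2) / 5) := by
    have := defectFive_elliptic' (add_div_five_mem hz (-2))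
    simp only [ofReal_neg, ofReal_ofNat, ← sub_eq_add_neg] at this
    rw [← this]
    congr 1
    rw [show 5 * ((z - 2) / 5) + 2 = z by ring]
    field_simp
    ring
  have c4 := defectFive_cusp_swap hz
  have c5 : defectFive ((-1 / z - 1) / 5) = defectFive ((z + 1) / 5) := by
    have := defectFive_cusp_swap (neg_inv_mem hz)
    rw [← this]
    congr 1
    field_simp
  rw [defectNorm, defectNorm, c0, c1, c2, c3, c4, c5]
  ring

theorem differentiableAt_defectNorm {z : ℂ} (hz : z ∈ ℍₒ) : DifferentiableAt ℂ defectNorm z := by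
  have h (x : ℝ) : DifferentiableAt ℂ (fun z : ℂ ↦ defectFive ((z + x) / 5)) z :=
    (differentiableAt_defectFive (add_div_five_mem hz x)).fun_comp' z (by fun_prop)
  have h0 := (differentiableAt_defectFive hz).fun_mul
    (((((h (-2)).fun_mul (h (-1))).fun_mul (h 0)).fun_mul (h 1)).fun_mul (h 2))
  simpa [← sub_eq_add_neg] using! h0

theorem tendsto_defectNorm : Tendsto defectNorm (comap Complex.im atTop) (𝓝 0) := by
  have h (x : ℝ) : Tendsto (fun z : ℂ ↦ defectFive ((z + x) / 5)) (comap Complex.im atTop)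
      (𝓝 0) := by
    refine tendsto_defectFive.comp (tendsto_comap_iff.2 ?_)
    have : Complex.im ∘ (fun z : ℂ ↦ (z + x) / 5) = (fun y ↦ y / 5) ∘ Complex.im := by
      ext z
      simp only [Function.comp_apply]
      rw [show (z + x) / 5 = (z + x) / ((5 : ℝ) : ℂ) by simp, Complex.div_ofReal_im]
      simp
    rw [this]
    exact (tendsto_id.atTop_div_const (by norm_num)).comp tendsto_comap
  have h0 := tendsto_defectFive.mul ((((((h (-2)).mul (h (-1))).mul (h 0)).mul (h 1)).mul (h 2)))
  simpa [← sub_eq_add_neg, defectNorm, Function.comp_def] using! h0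

theorem defectNorm_slash (γ : SL(2, ℤ)) :
    (fun τ : ℍ ↦ defectNorm τ) ∣[(0 : ℤ)] γ = fun τ : ℍ ↦ defectNorm τ := by
  refine SlashInvariantForm.slash_action_generators_SL2Z ?_ ?_ γ
  · ext τ
    rw [SL_slash_apply, UpperHalfPlane.modular_S_smul]
    have := defectNorm_neg_inv τ.2
    simp only [neg_zero, zpow_zero, mul_one]
    rw [← this]
    congr 1
    simp [neg_div, inv_neg]
  · ext τ
    rw [SL_slash_apply, UpperHalfPlane.modular_T_smul]
    have := defectNorm_add_one τ
    simp only [neg_zero, zpow_zero, mul_one]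
    rw [← this]
    congr 1
    simp [add_comm]

/-- `defectNorm` as a cusp form of weight zero and level one. -/
noncomputable def defectCuspForm : CuspForm 𝒮ℒ 0 where
  toFun := fun τ : ℍ ↦ defectNorm τ
  slash_action_eq' A hA := by
    obtain ⟨A, rfl⟩ := hA
    exact defectNorm_slash A
  holo' := by
    rw [UpperHalfPlane.mdifferentiable_iff]
    refine .congr (fun z hz ↦ (differentiableAt_defectNorm hz).differentiableWithinAt)
      fun z hz ↦ ?_
    simp [ofComplex_apply_of_im_pos hz]
  zero_at_cusps' hc := by
    rw [Subgroup.IsArithmetic.isCusp_iff_isCusp_SL2Z] at hc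
    rw [OnePoint.isZeroAt_iff_forall_SL2Z hc]
    intro γ _
    rw [defectNorm_slash]
    exact tendsto_defectNorm.comp tendsto_coe_atImInfty

theorem defectNorm_eq_zero {z : ℂ} (hz : z ∈ ℍₒ) : defectNorm z = 0 := by
  obtain ⟨c, hc⟩ := ModularFormClass.levelOne_weight_zero_const defectCuspForm
  have hc' (τ : ℍ) : defectNorm τ = c := congrFun hc τ
  have h := tendsto_defectNorm.comp tendsto_coe_atImInfty
  have h2 : Tendsto (fun _ : ℍ ↦ c) atImInfty (𝓝 0) := by
    simpa only [Function.comp_def, hc'] using h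
  rw [show defectNorm z = c from hc' ⟨z, hz⟩]
  exact tendsto_nhds_unique tendsto_const_nhds h2

theorem defectFive_eq_zero {z : ℂ} (hz : z ∈ ℍₒ) : defectFive z = 0 := by
  have hpre : IsPreconnected ℍₒ := Convex.isPreconnected (convex_halfSpace_im_gt 0)
  have han (x : ℝ) : AnalyticOnNhd ℂ (fun z : ℂ ↦ defectFive ((z + x) / 5)) ℍₒ :=
    DifferentiableOn.analyticOnNhd (fun w hw ↦
      ((differentiableAt_defectFive (add_div_five_mem hw x)).fun_comp' w
        (by fun_prop)).differentiableWithinAt) isOpen_upper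
  have h0 : AnalyticOnNhd ℂ defectFive ℍₒ :=
    DifferentiableOn.analyticOnNhd (fun w hw ↦
      (differentiableAt_defectFive hw).differentiableWithinAt) isOpen_upper
  have key (x : ℝ) (h : ∀ w ∈ ℍₒ, defectFive ((w + x) / 5) = 0) : defectFive z = 0 := by
    have h5 : 5 * z - x ∈ ℍₒ := by
      have hz' : 0 < z.im := hz
      simpa [upperHalfPlaneSet] using hz'
    rw [← h _ h5]
    congr 1
    ring
  have e0 := han 0
  have e1 := han 1
  have e2 := han 2
  have e3 := han (-1)
  have e4 := han (-2)
  rcases h0.eq_zero_or_eq_zero_of_mul_eq_zero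
    ((((e4.mul e3).mul e0).mul e1).mul e2) (fun w hw ↦ by
      simpa [defectNorm, ← sub_eq_add_neg] using defectNorm_eq_zero hw) hpre with h | h
  · exact h z hz
  rcases (((e4.mul e3).mul e0).mul e1).eq_zero_or_eq_zero_of_mul_eq_zero e2 h hpre with h | h
  swap
  · exact key _ h
  rcases ((e4.mul e3).mul e0).eq_zero_or_eq_zero_of_mul_eq_zero e1 h hpre with h | h
  swap
  · exact key _ h
  rcases (e4.mul e3).eq_zero_or_eq_zero_of_mul_eq_zero e0 h hpre with h | h
  swap
  · exact key _ h
  rcases e4.eq_zero_or_eq_zero_of_mul_eq_zero e3 h hpre with h | h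
  · exact key _ h
  · exact key _ h

theorem weightTwoFive_sq {z : ℂ} (hz : z ∈ ℍₒ) :
    weightTwoFive z ^ 2 =
      etaProductFive z * (1 / hauptmodulFive z + 22 + 125 * hauptmodulFive z) := by
  have h := defectFive_eq_zero hz
  have hD := etaProductFive_ne_zero hz
  rw [defectFive] at h
  have : weightTwoFive z ^ 2 / etaProductFive z =
      1 / hauptmodulFive z + 22 + 125 * hauptmodulFive z := by linear_combination h
  rw [← this, mul_div_cancel₀ _ hD]

theorem eulerF_pos {q : ℝ} (h0 : 0 < q) (h1 : q < 1) : 0 < eulerF q := by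
  have hq : |q| < 1 := by rwa [abs_of_pos h0]
  have hne : eulerF q ≠ 0 := by
    rw [← ofReal_ne_zero, ← eulerC_ofReal hq]
    exact eulerC_ne_zero (by simpa using hq)
  have hm : Multipliable fun n : ℕ ↦ 1 - q ^ (n + 1) := by
    apply multipliable_one_add_of_summable (f := fun n ↦ -q ^ (n + 1))
    simpa using (summable_nat_add_iff 1).mpr (summable_geometric_of_lt_one (abs_nonneg _) hq)
  refine lt_of_le_of_ne' (ge_of_tendsto' hm.hasProd fun s ↦ Finset.prod_nonneg fun n _ ↦ ?_) hne
  exact sub_nonneg.2 (pow_le_one₀ h0.le h1.le)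

/-- The Hauptmodul of `Γ₀(5)` as a function of a real nome. -/
noncomputable def hauptmodulReal (q : ℝ) : ℝ := q * (eulerF (q ^ 5) / eulerF q) ^ 6

theorem hauptmodulReal_pos {q : ℝ} (h0 : 0 < q) (h1 : q < 1) : 0 < hauptmodulReal q := by
  have := eulerF_pos h0 h1
  have := eulerF_pos (pow_pos h0 5) (pow_lt_one₀ h0.le h1 (by norm_num))
  unfold hauptmodulReal
  positivity

theorem ofReal_hauptmodulReal {q : ℝ} (hq : |q| < 1) :
    (hauptmodulReal q : ℂ) = q * hauptmodulSeries q := by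
  have hq5 : |q ^ 5| < 1 := by
    rw [abs_pow]
    exact pow_lt_one₀ (abs_nonneg _) hq (by norm_num)
  rw [hauptmodulReal, hauptmodulSeries, eulerC_ofReal hq, ← ofReal_pow, eulerC_ofReal hq5]
  push_cast
  rfl

theorem exists_exp_eq {q : ℝ} (h0 : 0 < q) (h1 : q < 1) :
    ∃ t : ℝ, 0 < t ∧ Real.exp (-(2 * π * t)) = q := by
  refine ⟨-Real.log q / (2 * π), div_pos (neg_pos.2 (Real.log_neg h0 h1)) (by positivity), ?_⟩
  rw [mul_div_cancel₀ _ (by positivity), neg_neg, Real.exp_log h0]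

theorem exists_hasDerivAt_hauptmodulReal {q : ℝ} (h0 : 0 < q) (h1 : q < 1) :
    ∃ d : ℝ, HasDerivAt hauptmodulReal d q ∧
      (q * d) ^ 2 = q * (eulerF q * eulerF (q ^ 5)) ^ 4 * (hauptmodulReal q *
        (1 + 22 * hauptmodulReal q + 125 * hauptmodulReal q ^ 2)) := by
  have hq : ‖(q : ℂ)‖ < 1 := by simpa [abs_of_pos h0] using h1
  have hd : HasDerivAt (fun w : ℂ ↦ w * hauptmodulSeries w)
      (1 * hauptmodulSeries q + q * deriv hauptmodulSeries q) (q : ℂ) :=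
    (hasDerivAt_id' (q : ℂ)).fun_mul (differentiableAt_hauptmodulSeries hq).hasDerivAt
  have hev : ∀ᶠ x : ℝ in 𝓝 q, |x| < 1 :=
    (isOpen_lt continuous_abs continuous_const).mem_nhds (by simpa [abs_of_pos h0] using h1)
  have hr : HasDerivAt hauptmodulReal
      (1 * hauptmodulSeries q + q * deriv hauptmodulSeries q).re q := by
    refine hd.real_of_complex.congr_of_eventuallyEq ?_
    filter_upwards [hev] with x hx
    rw [← ofReal_hauptmodulReal hx, ofReal_re]
  have hc : HasDerivAt (fun x : ℝ ↦ (hauptmodulReal x : ℂ))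
      (1 * hauptmodulSeries q + q * deriv hauptmodulSeries q) q := by
    refine hd.comp_ofReal.congr_of_eventuallyEq ?_
    filter_upwards [hev] with x hx
    exact ofReal_hauptmodulReal hx
  have heq := hr.ofReal_comp.unique hc
  refine ⟨_, hr, ?_⟩
  generalize (1 * hauptmodulSeries q + q * deriv hauptmodulSeries q).re = d at heq
  obtain ⟨t, ht, rfl⟩ := exists_exp_eq h0 h1
  have hw := weightTwoFive_sq (ofReal_mul_I_mem ht)
  rw [weightTwoFive_eq (ofReal_mul_I_mem ht), hauptmodulFive_ofReal_mul_I ht,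
    etaProductFive_ofReal_mul_I ht, cexp_ofReal_mul_I] at hw
  set q := Real.exp (-(2 * π * t))
  have hS := hauptmodulSeries_ne_zero hq
  have hu := ofReal_hauptmodulReal (q := q) (by rwa [abs_of_pos h0])
  have hup := hauptmodulReal_pos h0 h1
  have h2 : 1 + (q : ℂ) * (deriv hauptmodulSeries q / hauptmodulSeries q) =
      ((q * d / hauptmodulReal q : ℝ) : ℂ) := by
    push_cast
    rw [hu, heq]
    have : (q : ℂ) ≠ 0 := by exact_mod_cast h0.ne'
    field_simp
  rw [h2] at hw
  have hw' : (q * d / hauptmodulReal q) ^ 2 = q * (eulerF q * eulerF (q ^ 5)) ^ 4 *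
      (1 / hauptmodulReal q + 22 + 125 * hauptmodulReal q) := by
    apply ofReal_injective
    push_cast [hauptmodulReal] at hw ⊢
    exact hw
  field_simp at hw' ⊢
  linear_combination hw'

theorem tendsto_hauptmodulReal_zero : Tendsto hauptmodulReal (𝓝 0) (𝓝 0) := by
  have h : ContinuousAt (fun w : ℂ ↦ w * hauptmodulSeries w) ((0 : ℝ) : ℂ) :=
    continuousAt_id.mul (differentiableAt_hauptmodulSeries (by simp)).continuousAt
  have h2 := (continuous_re.continuousAt.comp h).comp continuous_ofReal.continuousAt
  have h3 : Tendsto (fun x : ℝ ↦ ((x : ℂ) * hauptmodulSeries x).re) (𝓝 0) (𝓝 0) := by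
    simpa [ContinuousAt, Function.comp_def] using h2
  refine h3.congr' ?_
  have hev : ∀ᶠ x : ℝ in 𝓝 0, |x| < 1 :=
    (isOpen_lt continuous_abs continuous_const).mem_nhds (by simp)
  filter_upwards [hev] with x hx
  rw [← ofReal_hauptmodulReal hx, ofReal_re]

theorem exists_hauptmodulReal_lt {ε : ℝ} (hε : 0 < ε) :
    ∃ q ∈ Set.Ioo (0 : ℝ) 1, hauptmodulReal q < ε := by
  have h := (tendsto_hauptmodulReal_zero.mono_left nhdsWithin_le_nhds).eventually_lt_const hε
    |>.and (Ioo_mem_nhdsGT (zero_lt_one' ℝ))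
  obtain ⟨q, hq, hq'⟩ := h.exists
  exact ⟨q, hq', hq⟩

theorem exists_hauptmodulReal_mul {q : ℝ} (hq : q ∈ Set.Ioo (0 : ℝ) 1) :
    ∃ p ∈ Set.Ioo (0 : ℝ) 1, hauptmodulReal p * hauptmodulReal q = 1 / 125 := by
  obtain ⟨t, ht, rfl⟩ := exists_exp_eq hq.1 hq.2
  have ht' : 0 < 1 / (5 * t) := by positivity
  refine ⟨Real.exp (-(2 * π * (1 / (5 * t)))), ⟨Real.exp_pos _, ?_⟩, ?_⟩
  · rw [Real.exp_lt_one_iff, neg_lt_zero]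
    positivity
  have h := hauptmodulFive_fricke (ofReal_mul_I_mem ht)
  have e : -1 / (5 * (t * I : ℂ)) = (1 / (5 * t) : ℝ) * I := by
    have : (t : ℂ) ≠ 0 := by exact_mod_cast ht.ne'
    push_cast
    field_simp
    simp
  rw [e, hauptmodulFive_ofReal_mul_I ht, hauptmodulFive_ofReal_mul_I ht'] at h
  apply ofReal_injective
  push_cast [hauptmodulReal] at h ⊢
  exact h

theorem injOn_hauptmodulReal : Set.InjOn hauptmodulReal (Set.Ioo 0 1) := by
  have hlt : ∀ a ∈ Set.Ioo (0 : ℝ) 1, ∀ b ∈ Set.Ioo (0 : ℝ) 1, a < b →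
      hauptmodulReal a ≠ hauptmodulReal b := by
    intro a ha b hb hab h
    have hsub : ∀ x ∈ Set.Icc a b, 0 < x ∧ x < 1 := fun x hx ↦
      ⟨ha.1.trans_le hx.1, hx.2.trans_lt hb.2⟩
    obtain ⟨c, hc, hc0⟩ := exists_deriv_eq_zero hab (fun x hx ↦ by
      obtain ⟨d, hd, -⟩ := exists_hasDerivAt_hauptmodulReal (hsub x hx).1 (hsub x hx).2
      exact hd.continuousAt.continuousWithinAt) h
    obtain ⟨h0, h1⟩ := hsub c ⟨hc.1.le, hc.2.le⟩
    obtain ⟨d, hd, hd2⟩ := exists_hasDerivAt_hauptmodulReal h0 h1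
    rw [hd.deriv] at hc0
    have h3 := hauptmodulReal_pos h0 h1
    have h4 := eulerF_pos h0 h1
    have h5 := eulerF_pos (pow_pos h0 5) (pow_lt_one₀ h0.le h1 (by norm_num))
    have : 0 < (c * d) ^ 2 := by
      rw [hd2]
      positivity
    simp [hc0] at this
  intro a ha b hb h
  rcases lt_trichotomy a b with hab | hab | hab
  · exact (hlt a ha b hb hab h).elim
  · exact hab
  · exact (hlt b hb a ha hab h.symm).elim

theorem image_hauptmodulReal : hauptmodulReal '' Set.Ioo 0 1 = Set.Ioi 0 := by
  refine Set.Subset.antisymm ?_ fun y hy ↦ ?_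
  · rintro _ ⟨q, hq, rfl⟩
    exact hauptmodulReal_pos hq.1 hq.2
  have hcont : ContinuousOn hauptmodulReal (Set.Ioo 0 1) := fun x hx ↦ by
    obtain ⟨d, hd, -⟩ := exists_hasDerivAt_hauptmodulReal hx.1 hx.2
    exact hd.continuousAt.continuousWithinAt
  have hy : 0 < y := hy
  obtain ⟨a, ha, hay⟩ := exists_hauptmodulReal_lt hy
  obtain ⟨p, hp, hpy⟩ := exists_hauptmodulReal_lt (ε := 1 / (125 * y)) (by positivity)
  obtain ⟨b, hb, hbp⟩ := exists_hauptmodulReal_mul hp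
  have hyb : y < hauptmodulReal b := by
    have h1 := hauptmodulReal_pos hp.1 hp.2
    have h2 := hauptmodulReal_pos hb.1 hb.2
    rw [lt_div_iff₀ (by positivity)] at hpy
    nlinarith
  exact ((isPreconnected_Ioo.image _ hcont).ordConnected.out
    (Set.mem_image_of_mem _ ha) (Set.mem_image_of_mem _ hb)) ⟨hay.le, hyb.le⟩

end ModularIdentity

theorem rpow_weight_identity {u : ℝ} (hu : 0 < u) :
    (11 * u / (1 + 11 * u)) ^ (-(1 : ℝ) / 3) * (1 - 11 * u / (1 + 11 * u)) ^ (-(2 : ℝ) / 3) *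
      (1 + 4 / 121 * (11 * u / (1 + 11 * u)) ^ 2) ^ (-(1 : ℝ) / 2) =
    (11 : ℝ) ^ (-(1 : ℝ) / 3) * u ^ (-(1 : ℝ) / 3) * (1 + 11 * u) ^ 2 /
      √(1 + 22 * u + 125 * u ^ 2) := by
  have hs : 0 < 1 + 11 * u := by positivity
  have e1 : 1 - 11 * u / (1 + 11 * u) = (1 + 11 * u)⁻¹ := by
    field_simp
    ring
  have e2 : 1 + 4 / 121 * (11 * u / (1 + 11 * u)) ^ 2 =
      (1 + 22 * u + 125 * u ^ 2) / (1 + 11 * u) ^ 2 := by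
    field_simp
    ring
  have e3 : ∀ x : ℝ, 0 ≤ x → x ^ (-(1 : ℝ) / 2) = (√x)⁻¹ := fun x hx ↦ by
    rw [neg_div, rpow_neg hx, Real.sqrt_eq_rpow]
  rw [e1, e2, e3 _ (by positivity), Real.sqrt_div (by positivity), Real.sqrt_sq hs.le,
    div_rpow (by positivity) hs.le, mul_rpow (by norm_num) hu.le, inv_rpow hs.le, div_eq_mul_inv,
    ← rpow_neg hs.le, ← rpow_neg hs.le]
  have e4 : (1 + 11 * u) ^ (-(-(1 : ℝ) / 3)) * (1 + 11 * u) ^ (-(-(2 : ℝ) / 3)) = 1 + 11 * u := by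
    rw [← rpow_add hs]
    norm_num
  have hP : 0 < √(1 + 22 * u + 125 * u ^ 2) := Real.sqrt_pos.2 (by positivity)
  calc _ = (11 : ℝ) ^ (-(1 : ℝ) / 3) * u ^ (-(1 : ℝ) / 3) *
        ((1 + 11 * u) ^ (-(-(1 : ℝ) / 3)) * (1 + 11 * u) ^ (-(-(2 : ℝ) / 3))) *
        (√(1 + 22 * u + 125 * u ^ 2) / (1 + 11 * u))⁻¹ := by ring
    _ = _ := by
      rw [e4]
      field_simp

theorem abs_deriv_mul_weight {q d : ℝ} (h0 : 0 < q) (h1 : q < 1)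
    (hd : (q * d) ^ 2 = q * (eulerF q * eulerF (q ^ 5)) ^ 4 * (hauptmodulReal q *
        (1 + 22 * hauptmodulReal q + 125 * hauptmodulReal q ^ 2))) :
    |d| * hauptmodulReal q ^ (-(1 : ℝ) / 3) /
        √(1 + 22 * hauptmodulReal q + 125 * hauptmodulReal q ^ 2) =
      eulerF (q ^ 5) ^ 3 * eulerF q * q ^ (-(1 : ℝ) / 3) := by
  have hu := hauptmodulReal_pos h0 h1
  have hA := eulerF_pos h0 h1
  have hB := eulerF_pos (pow_pos h0 5) (pow_lt_one₀ h0.le h1 (by norm_num))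
  set A := eulerF q
  set B := eulerF (q ^ 5)
  obtain ⟨r, hr, hq⟩ : ∃ r : ℝ, 0 < r ∧ q = r ^ 6 := by
    refine ⟨q ^ ((1 : ℝ) / 6), by positivity, ?_⟩
    rw [← rpow_natCast, ← rpow_mul h0.le]
    norm_num
  have hw : hauptmodulReal q = (r * B / A) ^ 6 := by
    rw [hauptmodulReal, hq]
    simp only [A, B, hq]
    ring
  have hcube : ∀ x : ℝ, 0 < x → (x ^ 6) ^ (-(1 : ℝ) / 3) = (x ^ 2)⁻¹ := fun x hx ↦ by
    rw [← rpow_natCast, ← rpow_mul hx.le, ← rpow_natCast, ← rpow_neg hx.le]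
    norm_num
  set u := hauptmodulReal q
  have hP : 0 < 1 + 22 * u + 125 * u ^ 2 := by positivity
  have hS : 0 < √(1 + 22 * u + 125 * u ^ 2) := Real.sqrt_pos.2 hP
  have hSq := Real.sq_sqrt hP.le
  generalize √(1 + 22 * u + 125 * u ^ 2) = s at *
  have hd' : q * |d| = r ^ 3 * (A * B) ^ 2 * (r * B / A) ^ 3 * s := by
    rw [← pow_left_inj₀ (by positivity) (by positivity) two_ne_zero, mul_pow, sq_abs, ← mul_pow,
      hd, ← hSq, hw, hq]
    ring
  have hd2 : |d| = r ^ 3 * (A * B) ^ 2 * (r * B / A) ^ 3 * s / q := by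
    rw [← hd', mul_div_cancel_left₀ _ h0.ne']
  rw [hd2, hw, hq, hcube _ (by positivity), hcube _ hr]
  field_simp

theorem integral_eulerF_eq :
    ∫ q in (0:ℝ)..1, eulerF (q ^ 5) ^ 3 * eulerF q * q ^ (-(1 : ℝ) / 3) =
      (11 : ℝ) ^ (-(2 : ℝ) / 3) * ∫ t in Set.Ioo (0 : ℝ) 1, t ^ (-(1 : ℝ) / 3) *
        (1 - t) ^ (-(2 : ℝ) / 3) * (1 + 4 / 121 * t ^ 2) ^ (-(1 : ℝ) / 2) := by
  choose! d hd hd2 using fun q (hq : q ∈ Set.Ioo (0 : ℝ) 1) ↦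
    exists_hasDerivAt_hauptmodulReal hq.1 hq.2
  have hpos : ∀ q ∈ Set.Ioo (0 : ℝ) 1, 0 < hauptmodulReal q := fun q hq ↦
    hauptmodulReal_pos hq.1 hq.2
  have himage : (fun q ↦ 11 * hauptmodulReal q / (1 + 11 * hauptmodulReal q)) '' Set.Ioo 0 1 =
      Set.Ioo (0 : ℝ) 1 := by
    rw [show (fun q ↦ 11 * hauptmodulReal q / (1 + 11 * hauptmodulReal q)) =
      (fun u : ℝ ↦ 11 * u / (1 + 11 * u)) ∘ hauptmodulReal from rfl, Set.image_comp,
      image_hauptmodulReal]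
    ext t
    constructor
    · rintro ⟨u, hu : 0 < u, rfl⟩
      refine ⟨by positivity, ?_⟩
      change 11 * u / (1 + 11 * u) < 1
      rw [div_lt_one (by positivity)]
      linarith
    · rintro ⟨ht0, ht1⟩
      have : 0 < 1 - t := by linarith
      refine ⟨t / (11 * (1 - t)), show 0 < t / (11 * (1 - t)) by positivity, ?_⟩
      change 11 * (t / (11 * (1 - t))) / (1 + 11 * (t / (11 * (1 - t)))) = t
      have h2 : 1 + 11 * (t / (11 * (1 - t))) = 1 / (1 - t) := by
        field_simp
        ring
      rw [h2]
      field_simp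
  have hderiv : ∀ q ∈ Set.Ioo (0 : ℝ) 1,
      HasDerivAt (fun q ↦ 11 * hauptmodulReal q / (1 + 11 * hauptmodulReal q))
        (11 * d q / (1 + 11 * hauptmodulReal q) ^ 2) q := by
    intro q hq
    have hs : 1 + 11 * hauptmodulReal q ≠ 0 := by
      have := hpos q hq
      positivity
    refine (((hd q hq).const_mul 11).fun_div (((hd q hq).const_mul 11).const_add 1)
      hs).congr_deriv ?_
    field_simp
    ring
  have hinj : Set.InjOn (fun q ↦ 11 * hauptmodulReal q / (1 + 11 * hauptmodulReal q))
      (Set.Ioo 0 1) := by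
    intro a ha b hb hab
    apply injOn_hauptmodulReal ha hb
    have h1 := hpos a ha
    have h2 := hpos b hb
    simp only at hab
    rw [div_eq_div_iff (by positivity) (by positivity)] at hab
    linear_combination hab / 11
  have hsubst := integral_image_eq_integral_abs_deriv_smul measurableSet_Ioo
    (fun q hq ↦ (hderiv q hq).hasDerivWithinAt) hinj
    fun t ↦ t ^ (-(1 : ℝ) / 3) * (1 - t) ^ (-(2 : ℝ) / 3) * (1 + 4 / 121 * t ^ 2) ^ (-(1 : ℝ) / 2)
  rw [himage] at hsubst
  rw [intervalIntegral.integral_of_le zero_le_one, integral_Ioc_eq_integral_Ioo, hsubst,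
    ← integral_const_mul]
  refine setIntegral_congr_fun measurableSet_Ioo fun q hq ↦ ?_
  have hu := hpos q hq
  simp only [smul_eq_mul]
  rw [rpow_weight_identity hu, ← abs_deriv_mul_weight hq.1 hq.2 (hd2 q hq), abs_div, abs_mul,
    abs_of_pos (show (0 : ℝ) < 11 by norm_num), abs_of_pos (show 0 < (1 + 11 * hauptmodulReal q) ^ 2
      by positivity)]
  have h11 : (11 : ℝ) ^ (-(2 : ℝ) / 3) * (11 : ℝ) ^ (-(1 : ℝ) / 3) = 11⁻¹ := by
    rw [← rpow_add (by norm_num), ← rpow_neg_one]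
    norm_num
  have hP : 0 < √(1 + 22 * hauptmodulReal q + 125 * hauptmodulReal q ^ 2) :=
    Real.sqrt_pos.2 (by positivity)
  generalize (11 : ℝ) ^ (-(2 : ℝ) / 3) = x at *
  generalize (11 : ℝ) ^ (-(1 : ℝ) / 3) = y at *
  generalize hauptmodulReal q ^ (-(1 : ℝ) / 3) = z at *
  generalize √(1 + 22 * hauptmodulReal q + 125 * hauptmodulReal q ^ 2) = s at *
  field_simp
  linear_combination (-11) * |d q| * z * h11

theorem beta_integrableOn_and_integral {a b : ℝ} (ha : 0 < a) (hb : 0 < b) :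
    IntegrableOn (fun t : ℝ ↦ t ^ (a - 1) * (1 - t) ^ (b - 1)) (Set.Ioo 0 1) ∧
      ∫ t in Set.Ioo (0 : ℝ) 1, t ^ (a - 1) * (1 - t) ^ (b - 1) =
        Real.Gamma a * Real.Gamma b / Real.Gamma (a + b) := by
  have hcongr : Set.EqOn (fun t : ℝ ↦ (t : ℂ) ^ ((a : ℂ) - 1) * (1 - (t : ℂ)) ^ ((b : ℂ) - 1))
      (fun t : ℝ ↦ ((t ^ (a - 1) * (1 - t) ^ (b - 1) : ℝ) : ℂ)) (Set.Ioo 0 1) := by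
    intro t ht
    have h1 : 0 ≤ 1 - t := sub_nonneg.2 ht.2.le
    simp only
    rw [Complex.ofReal_mul, Complex.ofReal_cpow ht.1.le, Complex.ofReal_cpow h1]
    push_cast
    rfl
  have hint := Complex.betaIntegral_convergent (u := a) (v := b) (by simpa) (by simpa)
  rw [intervalIntegrable_iff_integrableOn_Ioo_of_le zero_le_one,
    integrableOn_congr_fun hcongr measurableSet_Ioo] at hint
  have hval := Complex.betaIntegral_eq_Gamma_mul_div (u := a) (v := b) (by simpa) (by simpa)
  rw [Complex.betaIntegral, intervalIntegral.integral_of_le zero_le_one,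
    integral_Ioc_eq_integral_Ioo, setIntegral_congr_fun measurableSet_Ioo hcongr,
    integral_complex_ofReal, ← Complex.ofReal_add, Complex.Gamma_ofReal, Complex.Gamma_ofReal,
    Complex.Gamma_ofReal] at hval
  exact ⟨by simpa [IntegrableOn] using hint.re, by exact_mod_cast hval⟩

theorem Gamma_add_nat_eq_ascPochhammer {a : ℝ} (ha : 0 < a) (n : ℕ) :
    Real.Gamma (a + n) = (ascPochhammer ℝ n).eval a * Real.Gamma a := by
  induction n with
  | zero => simp
  | succ n ih =>
    have : a + (n : ℝ) ≠ 0 := by positivity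
    push_cast
    rw [← add_assoc, Real.Gamma_add_one this, ih, ascPochhammer_succ_eval]
    ring

theorem ascPochhammer_half_mul (n : ℕ) :
    (ascPochhammer ℝ n).eval (1 / 2) * (ascPochhammer ℝ (2 * n)).eval (2 / 3) * n.factorial =
      (ascPochhammer ℝ n).eval (1 / 3) * (ascPochhammer ℝ n).eval (5 / 6) *
        (2 * n).factorial := by
  induction n with
  | zero => simp
  | succ n ih =>
    rw [show 2 * (n + 1) = 2 * n + 1 + 1 by ring]
    simp only [ascPochhammer_succ_eval, Nat.factorial_succ]
    push_cast
    linear_combination (1 / 2 + n : ℝ) * (2 / 3 + 2 * n) * (2 / 3 + (2 * n + 1)) * (n + 1) * ih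

theorem hasSum_ascPochhammer_pow (a : ℝ) {x : ℝ} (hx : |x| < 1) :
    HasSum (fun n : ℕ ↦ (ascPochhammer ℝ n).eval a / n.factorial * x ^ n) ((1 - x) ^ (-a)) := by
  have h := (Real.one_div_one_sub_rpow_hasFPowerSeriesOnBall_zero a).hasSum (y := x)
    (by simpa [enorm_eq_nnnorm, ← NNReal.coe_lt_one] using hx)
  have hx1 : 0 ≤ 1 - x := by linarith [(abs_lt.1 hx).2]
  simp only [zero_add, one_div, ← rpow_neg hx1] at h
  refine h.congr_fun fun n ↦ ?_
  have h2 := Ring.factorial_nsmul_multichoose_eq_ascPochhammer a n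
  rw [nsmul_eq_mul, Polynomial.ascPochhammer_smeval_eq_eval] at h2
  have h3 : Ring.choose (a + n - 1) n = Ring.multichoose a n := by
    rw [Ring.choose]
    congr 1
    ring
  rw [← h2, FormalMultilinearSeries.ofScalars_apply_eq, h3, smul_eq_mul,
    mul_div_cancel_left₀ _ (by positivity)]

theorem hasSum_integral_weight :
    HasSum (fun n : ℕ ↦ (ascPochhammer ℝ n).eval (1 / 2) / n.factorial * (-4 / 121) ^ n *
        (Real.Gamma (2 / 3 + (2 * n : ℕ)) * Real.Gamma (1 / 3) / (2 * n).factorial))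
      (∫ t in Set.Ioo (0 : ℝ) 1, t ^ (-(1 : ℝ) / 3) * (1 - t) ^ (-(2 : ℝ) / 3) *
        (1 + 4 / 121 * t ^ 2) ^ (-(1 : ℝ) / 2)) := by
  have hbeta (n : ℕ) := beta_integrableOn_and_integral (a := 2 / 3 + (2 * n : ℕ)) (b := 1 / 3)
    (by positivity) (by norm_num)
  have hsplit (n : ℕ) : Set.EqOn (fun t : ℝ ↦ t ^ (2 / 3 + ((2 * n : ℕ) : ℝ) - 1) *
      (1 - t) ^ ((1 : ℝ) / 3 - 1)) (fun t ↦ t ^ (-(1 : ℝ) / 3) * (1 - t) ^ (-(2 : ℝ) / 3) *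
        t ^ (2 * n)) (Set.Ioo 0 1) := by
    intro t ht
    have e : (2 : ℝ) / 3 + ((2 * n : ℕ) : ℝ) - 1 = -(1 : ℝ) / 3 + ((2 * n : ℕ) : ℝ) := by ring
    simp only
    rw [e, rpow_add ht.1, rpow_natCast, show (1 : ℝ) / 3 - 1 = -(2 : ℝ) / 3 by norm_num]
    ring
  have hint (n : ℕ) : IntegrableOn (fun t : ℝ ↦ t ^ (-(1 : ℝ) / 3) * (1 - t) ^ (-(2 : ℝ) / 3) *
      t ^ (2 * n)) (Set.Ioo 0 1) :=
    (integrableOn_congr_fun (hsplit n) measurableSet_Ioo).1 (hbeta n).1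
  have hval (n : ℕ) : ∫ t in Set.Ioo (0 : ℝ) 1, t ^ (-(1 : ℝ) / 3) * (1 - t) ^ (-(2 : ℝ) / 3) *
      t ^ (2 * n) = Real.Gamma (2 / 3 + (2 * n : ℕ)) * Real.Gamma (1 / 3) /
        (2 * n).factorial := by
    rw [← setIntegral_congr_fun measurableSet_Ioo (hsplit n), (hbeta n).2,
      ← Real.Gamma_nat_eq_factorial (2 * n)]
    congr 2
    ring
  have hcoef (n : ℕ) : 0 ≤ (ascPochhammer ℝ n).eval (1 / 2) / n.factorial :=
    div_nonneg (ascPochhammer_pos n _ (by norm_num)).le (Nat.cast_nonneg _)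
  have hsum := (hasSum_ascPochhammer_pow (1 / 2) (x := 4 / 121)
    (by rw [abs_of_pos] <;> norm_num)).summable
  have hweight : ∀ t ∈ Set.Ioo (0 : ℝ) 1,
      0 ≤ t ^ (-(1 : ℝ) / 3) * (1 - t) ^ (-(2 : ℝ) / 3) := fun t ht ↦
    mul_nonneg (rpow_nonneg ht.1.le _) (rpow_nonneg (sub_nonneg.2 ht.2.le) _)
  have h := hasSum_integral_of_dominated_convergence (μ := volume.restrict (Set.Ioo (0 : ℝ) 1))
    (F := fun (n : ℕ) t ↦ (ascPochhammer ℝ n).eval (1 / 2) / n.factorial * (-4 / 121) ^ n *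
      (t ^ (-(1 : ℝ) / 3) * (1 - t) ^ (-(2 : ℝ) / 3) * t ^ (2 * n)))
    (f := fun t ↦ t ^ (-(1 : ℝ) / 3) * (1 - t) ^ (-(2 : ℝ) / 3) *
        (1 + 4 / 121 * t ^ 2) ^ (-(1 : ℝ) / 2))
    (fun n t ↦ (ascPochhammer ℝ n).eval (1 / 2) / n.factorial * (4 / 121) ^ n *
      (t ^ (-(1 : ℝ) / 3) * (1 - t) ^ (-(2 : ℝ) / 3)))
    (fun n ↦ ((hint n).const_mul _).aestronglyMeasurable) (fun n ↦ ?_)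
    (.of_forall fun t ↦ hsum.mul_right _) ?_ ?_
  · simpa only [integral_const_mul, hval] using h
  · filter_upwards [ae_restrict_mem measurableSet_Ioo] with t ht
    have h1 := hweight t ht
    have h2 : t ^ (2 * n) ≤ 1 := pow_le_one₀ ht.1.le ht.2.le
    have h3 : 0 ≤ t ^ (2 * n) := pow_nonneg ht.1.le _
    rw [norm_mul, norm_mul, norm_pow, Real.norm_of_nonneg (hcoef n),
      Real.norm_of_nonneg (mul_nonneg h1 h3), show ‖(-4 / 121 : ℝ)‖ = 4 / 121 by
        rw [Real.norm_eq_abs, abs_of_neg] <;> norm_num]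
    exact mul_le_mul_of_nonneg_left (mul_le_of_le_one_right h1 h2)
      (mul_nonneg (hcoef n) (by positivity))
  · simp only [tsum_mul_right]
    exact Integrable.const_mul (by simpa [IntegrableOn] using hint 0) _
  · filter_upwards [ae_restrict_mem measurableSet_Ioo] with t ht
    have ht2 : t ^ 2 < 1 := pow_lt_one₀ ht.1.le ht.2 two_ne_zero
    have h2 := (hasSum_ascPochhammer_pow (1 / 2) (x := -4 / 121 * t ^ 2) (by
      rw [abs_lt]
      constructor <;> nlinarith [sq_nonneg t])).mul_left
        (t ^ (-(1 : ℝ) / 3) * (1 - t) ^ (-(2 : ℝ) / 3))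
    rw [show 1 - -4 / 121 * t ^ 2 = 1 + 4 / 121 * t ^ 2 by ring,
      show -(1 / 2 : ℝ) = -1 / 2 by norm_num] at h2
    refine h2.congr_fun fun n ↦ ?_
    rw [mul_pow, pow_mul]
    ring

theorem Gamma_third_mul_Gamma_two_thirds :
    Real.Gamma (2 / 3) * Real.Gamma (1 / 3) = 2 * π / √3 := by
  have h := Real.Gamma_mul_Gamma_one_sub (1 / 3)
  rw [show π * (1 / 3) = π / 3 by ring, Real.sin_pi_div_three,
    show (1 : ℝ) - 1 / 3 = 2 / 3 by norm_num] at h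
  rw [mul_comm, h]
  field_simp

theorem integral_weight_eq :
    ∫ t in Set.Ioo (0 : ℝ) 1, t ^ (-(1 : ℝ) / 3) * (1 - t) ^ (-(2 : ℝ) / 3) *
      (1 + 4 / 121 * t ^ 2) ^ (-(1 : ℝ) / 2) =
    2 * π / √3 * hyp2F1 (1 / 3) (5 / 6) 1 (-4 / 121) := by
  rw [← hasSum_integral_weight.tsum_eq, hyp2F1, ← tsum_mul_left]
  congr 1
  ext n
  rw [Gamma_add_nat_eq_ascPochhammer (by norm_num), ← Gamma_third_mul_Gamma_two_thirds,
    ascPochhammer_eval_one]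
  have h := ascPochhammer_half_mul n
  have h1 : ((2 * n).factorial : ℝ) ≠ 0 := by positivity
  have h2 : (n.factorial : ℝ) ≠ 0 := by positivity
  generalize (ascPochhammer ℝ n).eval (1 / 2) = x at *
  generalize (ascPochhammer ℝ n).eval (1 / 3) = y at *
  generalize (ascPochhammer ℝ n).eval (5 / 6) = z at *
  generalize (ascPochhammer ℝ (2 * n)).eval (2 / 3) = w at *
  generalize Real.Gamma (2 / 3) = g at *
  generalize Real.Gamma (1 / 3) = k at *
  generalize ((-4 / 121 : ℝ)) ^ n = p at *
  field_simp
  linear_combination p * g * k * h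

theorem integral_f3f1 :
    ∫ q in (0:ℝ)..1, eulerF (q ^ 5) ^ 3 * eulerF q * q ^ (-(1 : ℝ) / 3) =
      (2 * π / ((11 : ℝ) ^ ((2 : ℝ) / 3) * Real.sqrt 3)) *
        hyp2F1 (1 / 3) (5 / 6) 1 (-4 / 121) := by
  rw [integral_eulerF_eq, integral_weight_eq, neg_div, rpow_neg (by norm_num)]
  field_simp
end
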